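/- arXiv:2306.14833 — 5 statements merged into one kernel-verified Lean document; each statement's English description precedes it below -/
import Mathlib

section
/- Let F be a field, D a subring of F, and Z a nonempty subset of Zar_F(D). Then the family of rings A(X(Z)), as X ranges over all projective models of F/D, is directed under inclusion, and its union equals A(Z). -/
/-!
Common definitions: valuation rings of a field, the Zariski--Riemann space
`Zar_F(D)` with its Zariski and patch topologies, domination of local subrings,
residual algebraicity, integral closedness, and projective models of `F/D`.
-/

variable {F : Type*} [Field F]

/-- `x` lies in the maximal ideal (set of nonunits) of the (local) subring `R` of `F`. -/
def MemMaxIdeal (R : Subring F) (x : F) : Prop :=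
  ∃ h : x ∈ R, ¬ IsUnit (⟨x, h⟩ : R)

/-- The local ring `R` dominates the local ring `S` (both subrings of `F`):
`S ⊆ R` and the maximal ideal of `R` contracts to the maximal ideal of `S`. -/
def Dominates (R S : Subring F) : Prop :=
  S ≤ R ∧ ∀ x ∈ S, (MemMaxIdeal S x ↔ MemMaxIdeal R x)

/-- `V` is a valuation ring of the field `F`: for every nonzero `x ∈ F`,
`x ∈ V` or `x⁻¹ ∈ V`. -/
def IsValSubring (V : Subring F) : Prop :=
  ∀ x : F, x ≠ 0 → x ∈ V ∨ x⁻¹ ∈ V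

/-- `Zar_F(D)`: the valuation rings of `F` containing `D`. -/
def zarSet (D : Subring F) : Set (Subring F) :=
  {V | IsValSubring V ∧ D ≤ V}

/-- `Dom_F(D)`: the valuation rings of `F` dominating the local subring `D`. -/
def domSet (D : Subring F) : Set (Subring F) :=
  {V | IsValSubring V ∧ Dominates V D}

/-- The Zariski topology on a collection `X` of subrings of `F`, with basic open sets
`U(x₁,…,xₙ) = {R ∈ X : x₁,…,xₙ ∈ R}`. -/
def zariskiTop (X : Set (Subring F)) : TopologicalSpace X :=
  TopologicalSpace.generateFrom
    {U | ∃ s : Finset F, U = {R : X | ∀ x ∈ s, x ∈ (R : Subring F)}}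

/-- The patch topology on a collection `X` of subrings of `F`: generated by the
quasicompact Zariski-open sets together with their complements. -/
def patchTop (X : Set (Subring F)) : TopologicalSpace X :=
  TopologicalSpace.generateFrom
    ({U | @IsOpen _ (zariskiTop X) U ∧ @IsCompact _ (zariskiTop X) U} ∪
      {V | ∃ U, @IsOpen _ (zariskiTop X) U ∧ @IsCompact _ (zariskiTop X) U ∧ V = Uᶜ})

/-- `R` is residually algebraic over `D`: the residue field extension
`D/m_D → R/m_R` is algebraic, i.e. each element of `R` satisfies, modulo the
maximal ideal of `R`, a monic polynomial with coefficients in `D`. -/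
def ResiduallyAlgebraic (D R : Subring F) : Prop :=
  ∀ x ∈ R, ∃ p : Polynomial F, p.Monic ∧ (∀ i, p.coeff i ∈ D) ∧ MemMaxIdeal R (p.eval x)

/-- `R` is integrally closed in `F`: every element of `F` integral over `R` lies in `R`. -/
def IntegrallyClosedIn (R : Subring F) : Prop :=
  ∀ x : F, (∃ p : Polynomial F, p.Monic ∧ (∀ i, p.coeff i ∈ R) ∧ p.eval x = 0) → x ∈ R

/-- The localization of the subring `A` of `F` at the prime ideal `P`, viewed as the
subring of `F` generated by the fractions `a/b` with `a, b ∈ A`, `b ∉ P`. -/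
def localizationSubring (A : Subring F) (P : Ideal A) : Subring F :=
  Subring.closure {z : F | ∃ a b : A, b ∉ P ∧ z = (a : F) * (b : F)⁻¹}

/-- The ring `D[x₁/xᵢ, …, xₙ/xᵢ]`. -/
def modelChart (D : Subring F) {n : ℕ} (x : Fin n → F) (i : Fin n) : Subring F :=
  Subring.closure ((D : Set F) ∪ {y | ∃ j, y = x j * (x i)⁻¹})

/-- `X` is the projective model of `F/D` defined by some nonzero elements
`x₀, …, xₙ` of `F`: the set of all localizations of the rings
`D[x₀/xᵢ, …, xₙ/xᵢ]` at their prime ideals. -/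
def IsProjModel (D : Subring F) (X : Set (Subring F)) : Prop :=
  ∃ (n : ℕ) (x : Fin (n + 1) → F), (∀ i, x i ≠ 0) ∧
    X = {R | ∃ (i : Fin (n + 1)) (P : Ideal (modelChart D x i)),
          P.IsPrime ∧ R = localizationSubring (modelChart D x i) P}

/-- `X(Z)`: the members of the projective model `X` dominated by some valuation ring
in `Z`. -/
def modelImage (X Z : Set (Subring F)) : Set (Subring F) :=
  {α ∈ X | ∃ V ∈ Z, Dominates V α}

/-- `A(Y)`: the intersection of a collection `Y` of subrings of `F`, as a subset of `F`. -/
def ringsInter (Y : Set (Subring F)) : Set F :=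
  ⋂ R ∈ Y, (R : Set F)

lemma memMaxIdeal_iff {R : Subring F} {x : F} :
    MemMaxIdeal R x ↔ x ∈ R ∧ (x = 0 ∨ x⁻¹ ∉ R) := by
  constructor
  · rintro ⟨hx, hu⟩
    refine ⟨hx, ?_⟩
    by_contra! hc
    exact hu (IsUnit.of_mul_eq_one (⟨x⁻¹, hc.2⟩ : R) (Subtype.ext (mul_inv_cancel₀ hc.1)))
  · rintro ⟨hx, h⟩
    refine ⟨hx, fun hu => ?_⟩
    obtain ⟨y, hy⟩ := hu.exists_right_inv
    have hxy : x * (y : F) = 1 := congrArg Subtype.val hy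
    rcases h with rfl | h
    · simp at hxy
    · exact h (inv_eq_of_mul_eq_one_right hxy ▸ y.2)

lemma Dominates.inv_mem {V R : Subring F} (h : Dominates V R) {x : F} (hx : x ∈ R)
    (hV : x⁻¹ ∈ V) : x⁻¹ ∈ R := by
  by_cases h0 : x = 0
  · simp [h0]
  by_contra hR
  have := (memMaxIdeal_iff.1 ((h.2 x hx).1 (memMaxIdeal_iff.2 ⟨hx, Or.inr hR⟩))).2
  tauto

lemma subset_localizationSubring (A : Subring F) {P : Ideal A} (hP : P.IsPrime) :
    A ≤ localizationSubring A P := fun a ha =>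
  Subring.subset_closure ⟨⟨a, ha⟩, 1, P.one_notMem, by simp⟩

lemma exists_of_mem_localizationSubring {A : Subring F} {P : Ideal A} (hP : P.IsPrime) {z : F}
    (hz : z ∈ localizationSubring A P) : ∃ a b : A, b ∉ P ∧ z = (a : F) * (b : F)⁻¹ := by
  have hne : ∀ {b : A}, b ∉ P → (b : F) ≠ 0 := fun hb h0 =>
    hb ((Subtype.ext h0 : _ = (0 : A)) ▸ P.zero_mem)
  induction hz using Subring.closure_induction with
  | mem z hz => exact hz
  | zero => exact ⟨0, 1, P.one_notMem, by simp⟩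
  | one => exact ⟨1, 1, P.one_notMem, by simp⟩
  | add x y _ _ hx hy =>
    obtain ⟨a, b, hb, rfl⟩ := hx
    obtain ⟨c, d, hd, rfl⟩ := hy
    refine ⟨a * d + c * b, b * d, hP.mul_notMem hb hd, ?_⟩
    have := hne hb
    have := hne hd
    push_cast
    field_simp
  | neg x _ hx =>
    obtain ⟨a, b, hb, rfl⟩ := hx
    exact ⟨-a, b, hb, by simp⟩
  | mul x y _ _ hx hy =>
    obtain ⟨a, b, hb, rfl⟩ := hx
    obtain ⟨c, d, hd, rfl⟩ := hy
    refine ⟨a * c, b * d, hP.mul_notMem hb hd, ?_⟩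
    push_cast
    rw [mul_inv]
    ring

/-- The center of a valuation ring `V` on a subring `A ⊆ V`: the prime ideal of `A` whose
localization is dominated by `V`, together with the minimality of that localization. -/
lemma exists_dominates_localizationSubring {A V : Subring F} (hV : IsValSubring V) (hAV : A ≤ V) :
    ∃ P : Ideal A, P.IsPrime ∧ Dominates V (localizationSubring A P) ∧
      ∀ R : Subring F, A ≤ R → Dominates V R → localizationSubring A P ≤ R := by
  have hVR : ∀ x : F, x ∈ V ∨ x⁻¹ ∈ V := fun x => by
    by_cases h0 : x = 0
    · exact Or.inl (h0 ▸ V.zero_mem)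
    · exact hV x h0
  let W : ValuationSubring F := ⟨V, hVR⟩
  let f : A →+* W := Subring.inclusion hAV
  let P : Ideal A := (IsLocalRing.maximalIdeal W).comap f
  have hP : P.IsPrime := Ideal.IsPrime.comap f
  have hmem : ∀ a : A, a ∈ P ↔ (a : F) = 0 ∨ (a : F)⁻¹ ∉ V := fun a => by
    have : a ∈ P ↔ MemMaxIdeal V (a : F) :=
      ⟨fun h => ⟨hAV a.2, h⟩, fun ⟨_, h⟩ => h⟩
    rw [this, memMaxIdeal_iff]
    exact and_iff_right (hAV a.2)
  have hle : ∀ R : Subring F, A ≤ R → (∀ x ∈ R, x⁻¹ ∈ V → x⁻¹ ∈ R) →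
      localizationSubring A P ≤ R := by
    intro R hAR hR
    refine Subring.closure_le.2 ?_
    rintro _ ⟨a, b, hb, rfl⟩
    rw [hmem] at hb
    push Not at hb
    exact R.mul_mem (hAR a.2) (hR _ (hAR b.2) hb.2)
  have hlocV := hle V hAV fun _ _ h => h
  refine ⟨P, hP, ⟨hlocV, fun x hx => ?_⟩, fun R hAR hR => hle R hAR fun x hx => hR.inv_mem hx⟩
  rw [memMaxIdeal_iff, memMaxIdeal_iff, and_iff_right hx, and_iff_right (hlocV hx)]
  refine or_congr_right' fun h0 => not_congr ⟨fun h => hlocV h, fun h => ?_⟩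
  obtain ⟨a, b, hb, rfl⟩ := exists_of_mem_localizationSubring hP hx
  refine Subring.subset_closure ⟨b, a, ?_, by simp⟩
  rw [hmem] at hb ⊢
  push Not at hb ⊢
  refine ⟨fun ha => h0 (by simp [ha]), ?_⟩
  have := V.mul_mem h hb.2
  rwa [mul_inv, inv_inv, mul_assoc, mul_inv_cancel₀ hb.1, mul_one] at this

lemma subset_modelChart (D : Subring F) {n : ℕ} (x : Fin n → F) (i : Fin n) :
    D ≤ modelChart D x i := fun _ h => Subring.subset_closure (Or.inl h)

lemma div_mem_modelChart (D : Subring F) {n : ℕ} (x : Fin n → F) (i j : Fin n) :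
    x j * (x i)⁻¹ ∈ modelChart D x i := Subring.subset_closure (Or.inr ⟨j, rfl⟩)

lemma modelChart_le {D R : Subring F} {n : ℕ} {x : Fin n → F} {i : Fin n} (hD : D ≤ R)
    (h : ∀ j, x j * (x i)⁻¹ ∈ R) : modelChart D x i ≤ R := by
  refine Subring.closure_le.2 (Set.union_subset hD ?_)
  rintro _ ⟨j, rfl⟩
  exact h j

/-- Among finitely many nonzero elements, one divides all the others in a valuation ring. -/
lemma IsValSubring.exists_div_mem {V : Subring F} (hV : IsValSubring V) {n : ℕ}
    (x : Fin (n + 1) → F) (hx : ∀ i, x i ≠ 0) : ∃ i, ∀ j, x j * (x i)⁻¹ ∈ V := by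
  induction n with
  | zero => exact ⟨0, fun j => by rw [Fin.fin_one_eq_zero j, mul_inv_cancel₀ (hx 0)]; exact V.one_mem⟩
  | succ n ih =>
    obtain ⟨i, hi⟩ := ih (fun k => x k.succ) fun k => hx k.succ
    rcases hV (x 0 * (x i.succ)⁻¹) (mul_ne_zero (hx _) (inv_ne_zero (hx _))) with h | h
    · exact ⟨i.succ, Fin.cases h hi⟩
    · refine ⟨0, Fin.cases (by simp [hx 0, V.one_mem]) fun k => ?_⟩
      have := V.mul_mem (hi k) h
      rwa [mul_inv, inv_inv, mul_comm (x 0)⁻¹, mul_assoc, inv_mul_cancel_left₀ (hx _)] at this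

/-- If `R` is dominated by `V ∈ Z` and contains a chart of a projective model `X`,
then `R` contains `A(X(Z))`. -/
lemma ringsInter_modelImage_subset {D V R : Subring F} {Z : Set (Subring F)}
    (hVZ : V ∈ Z) (hV : IsValSubring V) (hR : Dominates V R) {n : ℕ} (x : Fin (n + 1) → F)
    (i : Fin (n + 1)) (hi : modelChart D x i ≤ R) :
    ringsInter (modelImage {R | ∃ (i : Fin (n + 1)) (P : Ideal (modelChart D x i)),
      P.IsPrime ∧ R = localizationSubring (modelChart D x i) P} Z) ⊆ R := by
  obtain ⟨P, hP, hdom, hmin⟩ := exists_dominates_localizationSubring hV (hi.trans hR.1)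
  exact fun f hf => hmin R hi hR (Set.mem_iInter₂.1 hf _ ⟨⟨i, P, hP, rfl⟩, V, hVZ, hdom⟩)

lemma dominates_refl (V : Subring F) : Dominates V V := ⟨le_rfl, fun _ _ => Iff.rfl⟩

/-- For a nonempty subset `Z` of `Zar_F(D)`, the family of rings `A(X(Z))`, as `X`
ranges over the projective models of `F/D`, is directed under inclusion, and its
union is `A(Z)`. -/
theorem statement7 (D : Subring F) (Z : Set (Subring F))
    (hZ : Z ⊆ zarSet D) (hne : Z.Nonempty) :
    (∀ X₁ X₂ : Set (Subring F), IsProjModel D X₁ → IsProjModel D X₂ →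
      ∃ X₃ : Set (Subring F), IsProjModel D X₃ ∧
        ringsInter (modelImage X₁ Z) ⊆ ringsInter (modelImage X₃ Z) ∧
        ringsInter (modelImage X₂ Z) ⊆ ringsInter (modelImage X₃ Z)) ∧
    (⋃ X ∈ {X : Set (Subring F) | IsProjModel D X}, ringsInter (modelImage X Z)) =
      ringsInter Z := by
  refine ⟨?_, subset_antisymm ?_ fun f hf => ?_⟩
  · rintro _ _ ⟨n, x, hx, rfl⟩ ⟨m, y, hy, rfl⟩
    have hcard : (n + 1) * (m + 1) = (n * m + n + m) + 1 := by ring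
    let e : Fin (n + 1) × Fin (m + 1) ≃ Fin ((n * m + n + m) + 1) :=
      finProdFinEquiv.trans (finCongr hcard)
    let z : Fin ((n * m + n + m) + 1) → F := fun k => x (e.symm k).1 * y (e.symm k).2
    refine ⟨_, ⟨_, z, fun k => mul_ne_zero (hx _) (hy _), rfl⟩, ?_, ?_⟩
    all_goals
      refine Set.subset_iInter₂ ?_
      rintro _ ⟨⟨k, P, hP, rfl⟩, V, hVZ, hdom⟩
      have hchart := subset_localizationSubring (modelChart D z k) hP
      have hD := (subset_modelChart D z k).trans hchart
    · refine ringsInter_modelImage_subset hVZ (hZ hVZ).1 hdom x (e.symm k).1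
        (modelChart_le hD fun j => hchart ?_)
      have := div_mem_modelChart D z k (e (j, (e.symm k).2))
      simp only [z, Equiv.symm_apply_apply] at this
      rwa [mul_inv, mul_mul_mul_comm, mul_inv_cancel₀ (hy _), mul_one] at this
    · refine ringsInter_modelImage_subset hVZ (hZ hVZ).1 hdom y (e.symm k).2
        (modelChart_le hD fun j => hchart ?_)
      have := div_mem_modelChart D z k (e ((e.symm k).1, j))
      simp only [z, Equiv.symm_apply_apply] at this
      rwa [mul_inv, mul_mul_mul_comm, mul_inv_cancel₀ (hx _), one_mul] at this
  · refine Set.iUnion₂_subset ?_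
    rintro _ ⟨n, x, hx, rfl⟩
    refine Set.subset_iInter₂ fun V hVZ => ?_
    obtain ⟨hV, hDV⟩ := hZ hVZ
    obtain ⟨i, hi⟩ := hV.exists_div_mem x hx
    exact ringsInter_modelImage_subset hVZ hV (dominates_refl V) x i (modelChart_le hDV hi)
  · by_cases h0 : f = 0
    · refine Set.mem_iUnion₂.2 ⟨_, ⟨0, fun _ => 1, fun _ => one_ne_zero, rfl⟩, ?_⟩
      exact Set.mem_iInter₂.2 fun R _ => h0 ▸ R.zero_mem
    · refine Set.mem_iUnion₂.2 ⟨_, ⟨1, ![1, f], ?_, rfl⟩, Set.mem_iInter₂.2 ?_⟩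
      · simp [Fin.forall_fin_two, h0]
      · rintro _ ⟨⟨i, P, hP, rfl⟩, V, hVZ, hdom⟩
        have hmem := fun j => subset_localizationSubring _ hP (div_mem_modelChart D ![1, f] i j)
        have hfV : f ∈ V := Set.mem_iInter₂.1 hf V hVZ
        obtain rfl | rfl : i = 0 ∨ i = 1 := by fin_cases i <;> simp
        · simpa using hmem 1
        · have hinv := hmem 0
          simp only [Matrix.cons_val_zero, Matrix.cons_val_one, one_mul] at hinv
          simpa using hdom.inv_mem hinv (by simpa using hfV)
end

section
/- Let F be a field, D a subring of F, and Z a nonempty subset of Zar_F(D). Suppose Z = ⋂_i Z_i for a downward directed family {Z_i} of patch closed subsets of Zar_F(D). Then the family of rings A(Z_i) is directed under inclusion and A(Z) = ⋃_i A(Z_i). -/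
/-!
Common definitions: valuation rings of a field, the Zariski--Riemann space
`Zar_F(D)` with its Zariski and patch topologies, domination of local subrings,
residual algebraicity, integral closedness, and projective models of `F/D`.
-/

variable {F : Type*} [Field F]

open Filter in
/-- Every ultrafilter on `Zar_F(D)` has a limit for the constructible topology. -/
theorem exists_zarSet_mem_iff_eventually (D : Subring F) (L : Ultrafilter (zarSet D)) :
    ∃ V : zarSet D, ∀ x : F, x ∈ V.1 ↔ ∀ᶠ W in (L : Filter (zarSet D)), x ∈ W.1 := by
  let R : Subring F :=
    { carrier := {x | ∀ᶠ W in (L : Filter (zarSet D)), x ∈ W.1}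
      mul_mem' := fun ha hb => by
        filter_upwards [ha, hb] with W h₁ h₂ using mul_mem h₁ h₂
      one_mem' := Eventually.of_forall fun W => one_mem W.1
      add_mem' := fun ha hb => by
        filter_upwards [ha, hb] with W h₁ h₂ using add_mem h₁ h₂
      zero_mem' := Eventually.of_forall fun W => zero_mem W.1
      neg_mem' := fun ha => by
        filter_upwards [ha] with W h₁ using neg_mem h₁ }
  refine ⟨⟨R, fun x hx => ?_, fun x hx => ?_⟩, fun x => Iff.rfl⟩
  · exact Ultrafilter.eventually_or.mp (Eventually.of_forall fun W => W.2.1 x hx)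
  · exact Eventually.of_forall fun W => W.2.2 hx

open Filter in
theorem le_nhds_zariskiTop_iff {X : Set (Subring F)} (L : Filter X) (V : X) :
    L ≤ @nhds _ (zariskiTop X) V ↔ ∀ x ∈ V.1, ∀ᶠ W in L, x ∈ W.1 := by
  rw [zariskiTop, TopologicalSpace.nhds_generateFrom]
  simp only [le_iInf_iff, le_principal_iff]
  constructor
  · intro h x hx
    exact h {R | x ∈ R.1} ⟨hx, {x}, by simp⟩
  · rintro h _ ⟨hV, s, rfl⟩
    exact (eventually_all_finset s).mpr fun x hx => h x (hV x hx)

open Filter in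
theorem le_nhds_patchTop {X : Set (Subring F)} (L : Ultrafilter X) (V : X)
    (hV : ∀ x : F, x ∈ V.1 ↔ ∀ᶠ W in (L : Filter X), x ∈ W.1) :
    (L : Filter X) ≤ @nhds _ (patchTop X) V := by
  rw [patchTop, TopologicalSpace.nhds_generateFrom]
  simp only [le_iInf_iff, le_principal_iff]
  rintro U ⟨hVU, ⟨hU, -⟩ | ⟨U, hU, hUc, rfl⟩⟩
  · exact (le_nhds_zariskiTop_iff (L : Filter X) V).mpr (fun x hx => (hV x).mp hx)
      (@IsOpen.mem_nhds _ (zariskiTop X) _ _ hU hVU)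
  · refine Ultrafilter.compl_mem_iff_notMem.mpr fun hUL => hVU ?_
    obtain ⟨W, hWU, hW⟩ :=
      (@isCompact_iff_ultrafilter_le_nhds _ (zariskiTop X) U).mp hUc L (le_principal_iff.mpr hUL)
    have hpure : pure V ≤ @nhds _ (zariskiTop X) W :=
      (le_nhds_zariskiTop_iff _ W).mpr fun x hx =>
        (hV x).mpr ((le_nhds_zariskiTop_iff (L : Filter X) W).mp hW x hx)
    exact hpure (@IsOpen.mem_nhds _ (zariskiTop X) _ _ hU hWU)

open Filter in
/-- A downward directed family of patch closed sets, each containing a ring that omits `x`,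
has a ring omitting `x` in its intersection. -/
theorem exists_mem_iInter_notMem (D : Subring F) {ι : Type*} [Nonempty ι]
    (Zi : ι → Set ↥(zarSet D)) (hpc : ∀ i, @IsClosed _ (patchTop (zarSet D)) (Zi i))
    (hdir : ∀ i j, ∃ k, Zi k ⊆ Zi i ∩ Zi j) (x : F) (h : ∀ i, ∃ V ∈ Zi i, x ∉ V.1) :
    ∃ V ∈ ⋂ i, Zi i, x ∉ V.1 := by
  have hne : (⨅ i, 𝓟 (Zi i ∩ {V | x ∉ V.1})).NeBot := by
    refine iInf_neBot_of_directed' ?_ fun i => principal_neBot_iff.mpr (h i)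
    intro i j
    obtain ⟨k, hk⟩ := hdir i j
    exact ⟨k, principal_mono.mpr fun V hV => ⟨(hk hV.1).1, hV.2⟩,
      principal_mono.mpr fun V hV => ⟨(hk hV.1).2, hV.2⟩⟩
  let L := Ultrafilter.of (⨅ i, 𝓟 (Zi i ∩ {V | x ∉ V.1}))
  have hL : ∀ i, Zi i ∩ {V | x ∉ V.1} ∈ L := fun i =>
    Ultrafilter.of_le _ (mem_iInf_of_mem i (mem_principal_self _))
  obtain ⟨V, hV⟩ := exists_zarSet_mem_iff_eventually D L
  refine ⟨V, Set.mem_iInter.mpr fun i => ?_, fun hx => ?_⟩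
  · exact (@isClosed_iff_ultrafilter _ _ (patchTop (zarSet D))).mp (hpc i) V L
      (le_nhds_patchTop L V hV) (mem_of_superset (hL i) Set.inter_subset_left)
  · obtain ⟨W, hW, hW'⟩ := (((hV x).mp hx).and (hL (Classical.arbitrary ι))).exists
    exact hW'.2 hW

/-- If a nonempty subset `Z` of `Zar_F(D)` is the intersection of a downward directed
family `{Zᵢ}` of patch closed subsets of `Zar_F(D)`, then the family of rings `A(Zᵢ)`
is directed under inclusion and `A(Z) = ⋃ᵢ A(Zᵢ)`. -/
theorem statement9 (D : Subring F) {ι : Type*} [Nonempty ι]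
    (Zi : ι → Set ↥(zarSet D))
    (hpc : ∀ i, @IsClosed _ (patchTop (zarSet D)) (Zi i))
    (hdir : ∀ i j, ∃ k, Zi k ⊆ Zi i ∩ Zi j)
    (Z : Set ↥(zarSet D)) (hZ : Z = ⋂ i, Zi i) (hne : Z.Nonempty) :
    (∀ i j, ∃ k,
      (⋂ V ∈ Zi i, (V.1 : Set F)) ⊆ ⋂ V ∈ Zi k, (V.1 : Set F) ∧
      (⋂ V ∈ Zi j, (V.1 : Set F)) ⊆ ⋂ V ∈ Zi k, (V.1 : Set F)) ∧
    (⋂ V ∈ Z, (V.1 : Set F)) = ⋃ i, ⋂ V ∈ Zi i, (V.1 : Set F) := by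
  refine ⟨fun i j => ?_, Set.Subset.antisymm (fun x hx => ?_) (Set.iUnion_subset fun i => ?_)⟩
  · obtain ⟨k, hk⟩ := hdir i j
    exact ⟨k, Set.biInter_subset_biInter_left fun V hV => (hk hV).1,
      Set.biInter_subset_biInter_left fun V hV => (hk hV).2⟩
  · by_contra hx'
    simp only [Set.mem_iUnion, Set.mem_iInter, not_exists, not_forall] at hx'
    obtain ⟨V, hV, hxV⟩ := exists_mem_iInter_notMem D Zi hpc hdir x fun i => by
      obtain ⟨V, hV, h⟩ := hx' i
      exact ⟨V, hV, h⟩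
    exact hxV (Set.mem_iInter₂.mp hx V (hZ ▸ hV))
  · exact Set.biInter_subset_biInter_left fun V hV => Set.mem_iInter.mp (hZ ▸ hV) i
end

section
/- Let F be a field, D a subring of F, and Z a patch closed subset of Zar_F(D). Then Z is connected in the Zariski topology if and only if the closure of Z in the Zariski topology of Zar_F(D) is connected. -/
/-!
Common definitions: valuation rings of a field, the Zariski--Riemann space
`Zar_F(D)` with its Zariski and patch topologies, domination of local subrings,
residual algebraicity, integral closedness, and projective models of `F/D`.
-/

variable {F : Type*} [Field F]

/-- Zariski-open sets are closed under passing to larger valuation rings. -/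
theorem mem_of_le_of_isOpen_zariski {X : Set (Subring F)} {U : Set X}
    (hU : @IsOpen _ (zariskiTop X) U) {V W : X} (hVW : (V : Subring F) ≤ W) (hV : V ∈ U) :
    W ∈ U := by
  induction hU with
  | basic U h =>
    obtain ⟨s, rfl⟩ := h
    exact fun x hx => hVW (hV x hx)
  | univ => trivial
  | inter _ _ _ _ h₁ h₂ => exact ⟨h₁ hV.1, h₂ hV.2⟩
  | sUnion _ _ h =>
    obtain ⟨U, hU, hVU⟩ := hV
    exact ⟨U, hU, h U hU hVU⟩

/-- The valuation rings containing a given valuation ring form a chain. -/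
theorem IsValSubring.le_total_of_le {W V₁ V₂ : Subring F} (hW : IsValSubring W)
    (h₁ : W ≤ V₁) (h₂ : W ≤ V₂) : V₁ ≤ V₂ ∨ V₂ ≤ V₁ := by
  by_contra! h
  obtain ⟨x, hx₁, hx₂⟩ := SetLike.not_le_iff_exists.mp h.1
  obtain ⟨y, hy₂, hy₁⟩ := SetLike.not_le_iff_exists.mp h.2
  have hx : x ≠ 0 := fun h => hx₂ (h ▸ V₂.zero_mem)
  have hy : y ≠ 0 := fun h => hy₁ (h ▸ V₁.zero_mem)
  rcases hW (x * y⁻¹) (mul_ne_zero hx (inv_ne_zero hy)) with h | h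
  · refine hx₂ ?_
    have := V₂.mul_mem (h₂ h) hy₂
    rwa [inv_mul_cancel_right₀ hy] at this
  · refine hy₁ ?_
    have := V₁.mul_mem (h₁ h) hx₁
    rwa [mul_inv_rev, inv_inv, inv_mul_cancel_right₀ hx] at this

/-- The limit of an ultrafilter on a collection of subrings: the ring of those elements
which lie in almost all members. -/
def ultrafilterLimit {X : Set (Subring F)} (𝒰 : Ultrafilter X) : Subring F where
  carrier := {x | ∀ᶠ V : X in 𝒰, x ∈ (V : Subring F)}
  mul_mem' ha hb := by
    filter_upwards [ha, hb] with V h₁ h₂ using V.1.mul_mem h₁ h₂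
  one_mem' := Filter.Eventually.of_forall fun V => V.1.one_mem
  add_mem' ha hb := by
    filter_upwards [ha, hb] with V h₁ h₂ using V.1.add_mem h₁ h₂
  zero_mem' := Filter.Eventually.of_forall fun V => V.1.zero_mem
  neg_mem' ha := by
    filter_upwards [ha] with V h using V.1.neg_mem h

theorem mem_ultrafilterLimit {X : Set (Subring F)} {𝒰 : Ultrafilter X} {x : F} :
    x ∈ ultrafilterLimit 𝒰 ↔ ∀ᶠ V : X in 𝒰, x ∈ (V : Subring F) :=
  Iff.rfl

theorem ultrafilterLimit_mem_zarSet {D : Subring F} (𝒰 : Ultrafilter (zarSet D)) :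
    ultrafilterLimit 𝒰 ∈ zarSet D :=
  ⟨fun x hx => Ultrafilter.eventually_or.mp (.of_forall fun V => V.2.1 x hx),
    fun _ hx => Filter.Eventually.of_forall fun V => V.2.2 hx⟩

/-- A Zariski limit of an ultrafilter is contained in its ring-theoretic limit. -/
theorem le_ultrafilterLimit {X : Set (Subring F)} {𝒰 : Ultrafilter X} {W : X}
    (h : (𝒰 : Filter X) ≤ @nhds _ (zariskiTop X) W) : (W : Subring F) ≤ ultrafilterLimit 𝒰 := by
  intro x hx
  have hU : @IsOpen _ (zariskiTop X) {R : X | ∀ y ∈ ({x} : Finset F), y ∈ (R : Subring F)} :=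
    .basic _ ⟨{x}, rfl⟩
  have := h (@IsOpen.mem_nhds _ (zariskiTop X) _ _ hU (by simpa using hx))
  rw [mem_ultrafilterLimit]
  filter_upwards [this] with V hV using hV x (Finset.mem_singleton_self x)

theorem le_nhds_zariski_ultrafilterLimit {X : Set (Subring F)} (𝒰 : Ultrafilter X)
    (h : ultrafilterLimit 𝒰 ∈ X) :
    (𝒰 : Filter X) ≤ @nhds _ (zariskiTop X) ⟨ultrafilterLimit 𝒰, h⟩ := by
  rw [zariskiTop, TopologicalSpace.nhds_generateFrom]
  refine le_iInf₂ fun U hU => ?_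
  obtain ⟨hmem, s, rfl⟩ := hU
  exact Filter.le_principal_iff.mpr ((Filter.eventually_all_finset s).mpr hmem)

theorem le_nhds_patch_ultrafilterLimit {X : Set (Subring F)} (𝒰 : Ultrafilter X)
    (h : ultrafilterLimit 𝒰 ∈ X) :
    (𝒰 : Filter X) ≤ @nhds _ (patchTop X) ⟨ultrafilterLimit 𝒰, h⟩ := by
  rw [patchTop, TopologicalSpace.nhds_generateFrom]
  refine le_iInf₂ fun U hU => Filter.le_principal_iff.mpr ?_
  obtain ⟨hmem, ⟨hU, -⟩ | ⟨U, hU, hc, rfl⟩⟩ := hU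
  · exact le_nhds_zariski_ultrafilterLimit 𝒰 h
      (@IsOpen.mem_nhds _ (zariskiTop X) _ _ hU hmem)
  · refine Ultrafilter.compl_mem_iff_notMem.mpr fun hU𝒰 => hmem ?_
    obtain ⟨P, hP, hle⟩ :=
      (@isCompact_iff_ultrafilter_le_nhds _ (zariskiTop X) U).mp hc 𝒰
        (Filter.le_principal_iff.mpr hU𝒰)
    exact mem_of_le_of_isOpen_zariski hU (le_ultrafilterLimit hle) hP

/-- Every point in the Zariski closure of the difference of a patch closed set and a
Zariski-open set is contained in a member of that difference. -/
theorem exists_le_of_mem_closure_diff {D : Subring F} {Z U : Set (zarSet D)}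
    (hZ : @IsClosed _ (patchTop (zarSet D)) Z) (hU : @IsOpen _ (zariskiTop (zarSet D)) U)
    {W : zarSet D} (hW : W ∈ @closure _ (zariskiTop (zarSet D)) (Z \ U)) :
    ∃ V ∈ Z \ U, (W : Subring F) ≤ V := by
  obtain ⟨𝒰, h𝒰, hle⟩ := (@mem_closure_iff_ultrafilter _ _ _ (zariskiTop _)).mp hW
  have hmem := ultrafilterLimit_mem_zarSet 𝒰
  refine ⟨⟨ultrafilterLimit 𝒰, hmem⟩, ⟨?_, fun hlU => ?_⟩, le_ultrafilterLimit hle⟩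
  · exact (@isClosed_iff_ultrafilter _ _ (patchTop _)).mp hZ _ 𝒰
      (le_nhds_patch_ultrafilterLimit 𝒰 hmem) (Filter.mem_of_superset h𝒰 fun _ h => h.1)
  · have h₁ : U ∈ 𝒰 := le_nhds_zariski_ultrafilterLimit 𝒰 hmem
      (@IsOpen.mem_nhds _ (zariskiTop _) _ _ hU hlU)
    obtain ⟨V, hV₁, hV₂⟩ := 𝒰.nonempty_of_mem (Filter.inter_mem h₁ h𝒰)
    exact hV₂.2 hV₁

/-- A patch closed subset `Z` of `Zar_F(D)` is connected in the Zariski topology if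
and only if its Zariski closure is connected. -/
theorem statement10 (D : Subring F) (Z : Set ↥(zarSet D))
    (hZ : @IsClosed _ (patchTop (zarSet D)) Z) :
    @IsConnected _ (zariskiTop (zarSet D)) Z ↔
      @IsConnected _ (zariskiTop (zarSet D)) (@closure _ (zariskiTop (zarSet D)) Z) := by
  let := zariskiTop (zarSet D)
  refine ⟨fun h => h.closure, fun h => ⟨closure_nonempty_iff.mp h.1, ?_⟩⟩
  intro A B hA hB hZAB ⟨V₁, hV₁, hV₁A⟩ ⟨V₂, hV₂, hV₂B⟩
  by_contra hne
  have hdisj : ∀ V ∈ Z, V ∈ A → V ∉ B := fun V hV ha hb => hne ⟨V, hV, ha, hb⟩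
  have hcover : closure Z ⊆ closure (Z \ B) ∪ closure (Z \ A) := by
    rw [← closure_union]
    refine closure_mono fun V hV => ?_
    by_cases hb : V ∈ B
    · exact .inr ⟨hV, fun ha => hdisj V hV ha hb⟩
    · exact .inl ⟨hV, hb⟩
  obtain ⟨W, -, hW₁, hW₂⟩ := isPreconnected_closed_iff.mp h.2 _ _ isClosed_closure
    isClosed_closure hcover
    ⟨V₁, subset_closure hV₁, subset_closure ⟨hV₁, hdisj V₁ hV₁ hV₁A⟩⟩
    ⟨V₂, subset_closure hV₂, subset_closure ⟨hV₂, fun ha => hdisj V₂ hV₂ ha hV₂B⟩⟩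
  obtain ⟨P, ⟨hPZ, hPB⟩, hWP⟩ := exists_le_of_mem_closure_diff hZ hB hW₁
  obtain ⟨Q, ⟨hQZ, hQA⟩, hWQ⟩ := exists_le_of_mem_closure_diff hZ hA hW₂
  rcases W.2.1.le_total_of_le hWP hWQ with hle | hle
  · exact hQA (mem_of_le_of_isOpen_zariski hA hle ((hZAB hPZ).resolve_right hPB))
  · exact hPB (mem_of_le_of_isOpen_zariski hB hle ((hZAB hQZ).resolve_left hQA))
end

section
/- Let S be the inverse limit of an inverse system of topological spaces X_i over a directed index set, and suppose each projection map d_i : S → X_i is a closed map. Let Z be a nonempty closed quasicompact subset of S. Then Z is connected if and only if d_i(Z) is connected for every i. -/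
/-!
Inverse limits of inverse systems of topological spaces over a directed index set.
For `i ≥ j`, `f h : X i → X j` (with `h : j ≤ i`) is the transition map `d_{j,i}`.
-/

variable {ι : Type*} [Preorder ι]

/-- The inverse limit of an inverse system of spaces `X i` with transition maps
`f h : X i → X j` for `h : j ≤ i`, as a subspace of the product `Π i, X i`. -/
def InvLim (X : ι → Type*) (f : ∀ ⦃i j : ι⦄, j ≤ i → X i → X j) : Type _ :=
  {s : ∀ i, X i // ∀ ⦃i j : ι⦄ (h : j ≤ i), f h (s i) = s j}

instance (X : ι → Type*) [∀ i, TopologicalSpace (X i)]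
    (f : ∀ ⦃i j : ι⦄, j ≤ i → X i → X j) : TopologicalSpace (InvLim X f) :=
  inferInstanceAs
    (TopologicalSpace {s : ∀ i, X i // ∀ ⦃i j : ι⦄ (h : j ≤ i), f h (s i) = s j})

/-- The `i`-th projection map `d_i` of an inverse limit. -/
def invProj (X : ι → Type*) (f : ∀ ⦃i j : ι⦄, j ≤ i → X i → X j) (i : ι) :
    InvLim X f → X i :=
  fun s => s.1 i

theorem continuous_invProj (X : ι → Type*) [∀ i, TopologicalSpace (X i)]
    (f : ∀ ⦃i j : ι⦄, j ≤ i → X i → X j) (i : ι) : Continuous (invProj X f i) :=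
  (continuous_apply i).comp continuous_subtype_val

theorem invProj_eq_of_le {X : ι → Type*} {f : ∀ ⦃i j : ι⦄, j ≤ i → X i → X j}
    {x y : InvLim X f} {i j : ι} (h : j ≤ i) (hxy : invProj X f i x = invProj X f i y) :
    invProj X f j x = invProj X f j y :=
  (x.2 h).symm.trans ((congrArg (f h) hxy).trans (y.2 h))

/-- A point of an inverse limit all of whose projections lie in the projections of a
closed set `B` belongs to `B`. -/
theorem IsClosed.mem_of_forall_invProj_mem [IsDirected ι (· ≤ ·)] [Nonempty ι]
    {X : ι → Type*} [∀ i, TopologicalSpace (X i)]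
    {f : ∀ ⦃i j : ι⦄, j ≤ i → X i → X j} {B : Set (InvLim X f)} (hB : IsClosed B)
    {x : InvLim X f} (hx : ∀ i, invProj X f i x ∈ invProj X f i '' B) : x ∈ B := by
  by_contra hxB
  obtain ⟨T, hT, hTB⟩ := isOpen_induced_iff.mp hB.isOpen_compl
  have hxT : x.1 ∈ T := hTB.superset hxB
  obtain ⟨F, u, hu, hFT⟩ := isOpen_pi_iff.mp hT x.1 hxT
  obtain ⟨i, hi⟩ := F.exists_le
  obtain ⟨b, hb, hbx⟩ := hx i
  have hbT : b ∈ Subtype.val ⁻¹' T := hFT fun j hj => by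
    have hbj : b.1 j = x.1 j := invProj_eq_of_le (hi j hj) hbx
    exact hbj ▸ (hu j hj).2
  exact (hTB.subset hbT : b ∈ Bᶜ) hb

/-- Let `S` be the inverse limit of an inverse system of topological spaces over a
directed index set, with closed projection maps `d_i`. A nonempty closed
quasicompact subset `Z` of `S` is connected if and only if `d_i(Z)` is connected
for every `i`. -/
theorem statement11 [IsDirected ι (· ≤ ·)] [Nonempty ι]
    (X : ι → Type*) [∀ i, TopologicalSpace (X i)]
    (f : ∀ ⦃i j : ι⦄, j ≤ i → X i → X j)
    (hcont : ∀ ⦃i j : ι⦄ (h : j ≤ i), Continuous (f h))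
    (hid : ∀ (i : ι) (x : X i), f (le_refl i) x = x)
    (hcomp : ∀ ⦃i j k : ι⦄ (hji : j ≤ i) (hkj : k ≤ j) (x : X i),
      f hkj (f hji x) = f (hkj.trans hji) x)
    (hclosedmap : ∀ i, IsClosedMap (invProj X f i))
    (Z : Set (InvLim X f)) (hne : Z.Nonempty) (hZc : IsClosed Z) (hZk : IsCompact Z) :
    IsConnected Z ↔ ∀ i, IsConnected (invProj X f i '' Z) := by
  refine ⟨fun h i => h.image _ (continuous_invProj X f i).continuousOn, fun h => ⟨hne, ?_⟩⟩
  rw [isPreconnected_closed_iff]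
  intro t t' ht ht' hZ htne ht'ne
  have hA : IsClosed (Z ∩ t) := hZc.inter ht
  have hB : IsClosed (Z ∩ t') := hZc.inter ht'
  let K : ι → Set (InvLim X f) := fun i =>
    (Z ∩ t) ∩ invProj X f i ⁻¹' (invProj X f i '' (Z ∩ t'))
  have hKc : ∀ i, IsClosed (K i) := fun i =>
    hA.inter ((hclosedmap i _ hB).preimage (continuous_invProj X f i))
  have hKne : ∀ i, (K i).Nonempty := by
    intro i
    obtain ⟨_, -, ⟨a, ha, rfl⟩, hb⟩ := isPreconnected_closed_iff.mp (h i).isPreconnected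
      (invProj X f i '' (Z ∩ t)) (invProj X f i '' (Z ∩ t'))
      (hclosedmap i _ hA) (hclosedmap i _ hB)
      (by
        rw [← Set.image_union, ← Set.inter_union_distrib_left]
        exact Set.image_mono (Set.subset_inter subset_rfl hZ))
      (by
        obtain ⟨a, ha⟩ := htne
        exact ⟨_, Set.mem_image_of_mem _ ha.1, Set.mem_image_of_mem _ ha⟩)
      (by
        obtain ⟨b, hb⟩ := ht'ne
        exact ⟨_, Set.mem_image_of_mem _ hb.1, Set.mem_image_of_mem _ hb⟩)
    exact ⟨a, ha, hb⟩
  have hKanti : Antitone K := by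
    rintro j i hji x ⟨hx, b, hb, hbx⟩
    exact ⟨hx, b, hb, invProj_eq_of_le hji hbx⟩
  obtain ⟨x, hx⟩ := IsCompact.nonempty_iInter_of_directed_nonempty_isCompact_isClosed K
    hKanti.directed_ge hKne
    (fun i => hZk.of_isClosed_subset (hKc i) fun _ hy => hy.1.1) hKc
  have hxK : ∀ i, x ∈ K i := Set.mem_iInter.mp hx
  obtain ⟨i⟩ := ‹Nonempty ι›
  exact ⟨x, (hxK i).1.1, (hxK i).1.2, (hB.mem_of_forall_invProj_mem fun j => (hxK j).2).2⟩
end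

section
/- Let F be a field and let D ⊆ R be local subrings of F such that R dominates D, R is integrally closed in F, and R is residually algebraic over D. Then Dom_F(R) is a closed and connected subset of Dom_F(D) in the Zariski topology. -/
/-!
Common definitions: valuation rings of a field, the Zariski--Riemann space
`Zar_F(D)` with its Zariski and patch topologies, domination of local subrings,
residual algebraicity, integral closedness, and projective models of `F/D`.
-/

variable {F : Type*} [Field F]

section

open Polynomial IsLocalRing

lemma ValuationSubring.exists_limit {ι : Type*} [Nonempty ι] (t : ι → Set (ValuationSubring F))
    (hdir : Directed (· ≥ ·) t) (hne : ∀ i, (t i).Nonempty) :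
    ∃ W : ValuationSubring F,
      (∀ s : Finset F, (∀ y ∈ s, y ∈ W) → ∀ i, ∃ V ∈ t i, ∀ y ∈ s, y ∈ V) ∧
      ∀ i y, (∀ V ∈ t i, y ∈ V) → y ∈ W := by
  have hdir' : Directed (· ≥ ·) fun i ↦ Filter.principal (t i) :=
    fun i j ↦ (hdir i j).imp fun k hk ↦ ⟨Filter.principal_mono.2 hk.1, Filter.principal_mono.2 hk.2⟩
  have : (⨅ i, Filter.principal (t i)).NeBot :=
    Filter.iInf_neBot_of_directed' hdir' fun i ↦ Filter.principal_neBot_iff.2 (hne i)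
  let U := Ultrafilter.of (⨅ i, Filter.principal (t i))
  have hU : ∀ i, ∀ᶠ V in (U : Filter (ValuationSubring F)), V ∈ t i := fun i ↦
    Ultrafilter.of_le _ (Filter.mem_iInf_of_mem i (Filter.mem_principal_self _))
  let W : ValuationSubring F :=
    { carrier := {y | ∀ᶠ V in (U : Filter (ValuationSubring F)), y ∈ V}
      mul_mem' := fun ha hb ↦ by
        filter_upwards [ha, hb] with V h1 h2 using V.mul_mem _ _ h1 h2
      one_mem' := Filter.Eventually.of_forall fun V ↦ V.one_mem
      add_mem' := fun ha hb ↦ by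
        filter_upwards [ha, hb] with V h1 h2 using V.add_mem _ _ h1 h2
      zero_mem' := Filter.Eventually.of_forall fun V ↦ V.zero_mem
      neg_mem' := fun ha ↦ by filter_upwards [ha] with V h1 using V.neg_mem _ h1
      mem_or_inv_mem' := fun y ↦ Ultrafilter.eventually_or.1
        (Filter.Eventually.of_forall fun V ↦ V.mem_or_inv_mem y) }
  refine ⟨W, fun s hs i ↦ ?_, fun i y hy ↦ (hU i).mono hy⟩
  have h : ∀ᶠ V in (U : Filter (ValuationSubring F)), ∀ y ∈ s, y ∈ V :=
    (Filter.eventually_all_finset s).2 hs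
  exact ((hU i).and h).exists

lemma Ideal.exists_pow_smul_inf_le {A M : Type*} [CommRing A] [IsNoetherianRing A]
    [AddCommGroup M] [Module A M] (I : Ideal A) (T E : Submodule A M) (hT : T.FG) :
    ∃ k, ∀ n, I ^ (n + k) • T ⊓ E ≤ I ^ n • E := by
  have : Module.Finite A T := Module.Finite.iff_fg.2 hT
  obtain ⟨k, hk⟩ := I.exists_pow_inf_eq_pow_smul (E.comap T.subtype)
  refine ⟨k, fun n y hy ↦ ?_⟩
  have hyT : y ∈ T := Submodule.smul_le_right hy.1
  have h1 : (⟨y, hyT⟩ : T) ∈ I ^ (n + k) • (⊤ : Submodule A T) ⊓ E.comap T.subtype := by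
    refine ⟨?_, hy.2⟩
    have : y ∈ (I ^ (n + k) • (⊤ : Submodule A T)).map T.subtype := by
      rw [Submodule.map_smul'', Submodule.map_top, Submodule.range_subtype]
      exact hy.1
    obtain ⟨z, hz, rfl⟩ := this
    exact hz
  rw [hk _ (Nat.le_add_left _ _), Nat.add_sub_cancel] at h1
  have h2 : y ∈ (I ^ n • (E.comap T.subtype)).map T.subtype :=
    ⟨_, Submodule.smul_mono le_rfl inf_le_right h1, rfl⟩
  rw [Submodule.map_smul''] at h2
  exact Submodule.smul_mono le_rfl (Submodule.map_comap_le _ _) h2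

/-- Gluing up to an error in `I`: if `M = S + S' + T` with `T` finite, sections of `S` and `S'`
that agree modulo a high power of `I` come from `S ∩ S'` modulo `I`. -/
lemma Ideal.exists_sub_mem_smul {A M : Type*} [CommRing A] [IsNoetherianRing A]
    [AddCommGroup M] [Module A M] (I : Ideal A) (S S' T : Submodule A M) (hT : T.FG) :
    ∃ n, ∀ a ∈ S, ∀ a' ∈ S', a - a' ∈ I ^ n • (S ⊔ S' ⊔ T) →
      ∃ r ∈ S ⊓ S', a - r ∈ I • S := by
  let E := S ⊓ (S' ⊔ T)
  obtain ⟨k, hk⟩ := I.exists_pow_smul_inf_le (T.map S'.mkQ) (E.map S'.mkQ) (hT.map _)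
  refine ⟨1 + k, fun a ha a' ha' h ↦ ?_⟩
  rw [sup_assoc, Submodule.smul_sup] at h
  obtain ⟨s, hs, l, hl, hsl⟩ := Submodule.mem_sup.1 h
  have hf : a - s = a' + l := by rw [sub_eq_iff_eq_add, add_assoc, add_comm l s, hsl]; abel
  have hfE : a - s ∈ E := by
    refine ⟨S.sub_mem ha (Submodule.smul_le_right hs), ?_⟩
    rw [hf]
    exact Submodule.add_mem _ (Submodule.mem_sup_left ha') (Submodule.smul_le_right hl)
  have h1 : S'.mkQ (a - s) ∈ I ^ (1 + k) • T.map S'.mkQ := by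
    rw [hf, map_add, S'.mkQ_apply a', (Submodule.Quotient.mk_eq_zero S').2 ha', zero_add]
    have := Submodule.mem_map_of_mem (f := S'.mkQ) hl
    rw [Submodule.map_smul''] at this
    simpa [Submodule.map_sup, Submodule.mkQ_map_self] using this
  have h2 := hk 1 ⟨h1, Submodule.mem_map_of_mem hfE⟩
  rw [pow_one, ← Submodule.map_smul''] at h2
  obtain ⟨g, hg, hgf⟩ := h2
  have h3 : a - s - g ∈ S' := by
    rw [← Submodule.Quotient.mk_eq_zero S', ← Submodule.mkQ_apply, map_sub, hgf, sub_self]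
  refine ⟨a - s - g, ⟨(E.sub_mem hfE (Submodule.smul_le_right hg)).1, h3⟩, ?_⟩
  have : a - (a - s - g) = s + g := by abel
  rw [this]
  refine Submodule.add_mem _ (Submodule.smul_mono_left ?_ hs)
    (Submodule.smul_mono le_rfl inf_le_left hg)
  exact Ideal.pow_le_self (by omega)

lemma Polynomial.exists_approx_idempotent (n : ℕ) :
    ∃ p : ℤ[X], (X * (1 - X)) ^ n ∣ p * (1 - p) ∧ X * (1 - X) ∣ p - X := by
  suffices ∃ p : ℤ[X], (X * (1 - X)) ^ (n + 1) ∣ p * (1 - p) ∧ X * (1 - X) ∣ p - X from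
    this.imp fun p h ↦ ⟨(pow_dvd_pow _ n.le_succ).trans h.1, h.2⟩
  induction n with
  | zero => exact ⟨X, by simp, by simp⟩
  | succ n ih =>
    obtain ⟨p, h1, h2⟩ := ih
    refine ⟨p ^ 2 * (3 - 2 * p), ?_, ?_⟩
    · have : p ^ 2 * (3 - 2 * p) * (1 - p ^ 2 * (3 - 2 * p)) =
        (p * (1 - p)) * (p * (1 - p)) * ((3 - 2 * p) * (1 + 2 * p)) := by ring
      rw [this, pow_succ]
      exact ((mul_dvd_mul h1 ((dvd_pow_self _ n.succ_ne_zero).trans h1))).mul_right _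
    · have : p ^ 2 * (3 - 2 * p) - X = (p * (1 - p)) * (2 * p - 1) + (p - X) := by ring
      rw [this]
      exact dvd_add (((dvd_pow_self _ n.succ_ne_zero).trans h1).mul_right _) h2

lemma LocalSubring.le_iff_mem_maximalIdeal {R S : LocalSubring F} :
    R ≤ S ↔ ∃ h : R.toSubring ≤ S.toSubring, ∀ y ∈ maximalIdeal R.toSubring,
      Subring.inclusion h y ∈ maximalIdeal S.toSubring := by
  rw [LocalSubring.le_def]
  refine exists_congr fun h ↦ ((local_hom_TFAE (Subring.inclusion h)).out 0 3).trans ?_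
  rfl

lemma LocalSubring.le_toLocalSubring_iff {R : LocalSubring F} {V : ValuationSubring F} :
    R ≤ V.toLocalSubring ↔ R.toSubring ≤ V.toSubring ∧
      ∀ y : R.toSubring, y ∈ maximalIdeal R.toSubring → (y : F) ∈ V.nonunits := by
  rw [le_iff_mem_maximalIdeal]
  constructor
  · rintro ⟨h, h'⟩
    exact ⟨h, fun y hy ↦ V.coe_mem_nonunits_iff.2 (h' y hy)⟩
  · rintro ⟨h, h'⟩
    exact ⟨h, fun y hy ↦ V.coe_mem_nonunits_iff.1 (h' y hy)⟩

lemma LocalSubring.mem_maximalIdeal_of_mem_nonunits {R : LocalSubring F} {V : ValuationSubring F}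
    (h : R ≤ V.toLocalSubring) {y : R.toSubring} (hy : (y : F) ∈ V.nonunits) :
    y ∈ maximalIdeal R.toSubring := by
  rw [mem_maximalIdeal, mem_nonunits_iff]
  intro hu
  have := (hu.map (Subring.inclusion h.1))
  exact (V.coe_mem_nonunits_iff (a := ⟨y, h.1 y.2⟩)).1 hy this

lemma LocalSubring.algebraMap_mem_maximalIdeal_ofPrime {S : Subring F} {N : Ideal S} [N.IsPrime]
    (g : S) : Subring.inclusion (le_ofPrime S N) g ∈ maximalIdeal (ofPrime S N).toSubring ↔ g ∈ N :=
  IsLocalization.AtPrime.to_map_mem_maximal_iff _ N g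

lemma LocalSubring.le_ofPrime_of_mem {R : LocalSubring F} {S : Subring F} {N : Ideal S} [N.IsPrime]
    (h : R.toSubring ≤ S)
    (hN : ∀ y : R.toSubring, y ∈ maximalIdeal R.toSubring → Subring.inclusion h y ∈ N) :
    R ≤ ofPrime S N :=
  le_iff_mem_maximalIdeal.2 ⟨h.trans (le_ofPrime S N), fun y hy ↦
    (algebraMap_mem_maximalIdeal_ofPrime (Subring.inclusion h y)).2 (hN y hy)⟩

lemma LocalSubring.mem_nonunits_iff_of_ofPrime_le {S : Subring F} {N : Ideal S} [N.IsPrime]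
    {V : ValuationSubring F} (h : ofPrime S N ≤ V.toLocalSubring) (g : S) :
    (g : F) ∈ V.nonunits ↔ g ∈ N := by
  rw [← algebraMap_mem_maximalIdeal_ofPrime g]
  exact ⟨fun hg ↦ mem_maximalIdeal_of_mem_nonunits h hg, fun hg ↦ (le_toLocalSubring_iff.1 h).2 _ hg⟩

lemma LocalSubring.isIntegrallyClosedIn_ofPrime (S : Subring F) (N : Ideal S) [N.IsPrime]
    [IsIntegrallyClosedIn S F] : IsIntegrallyClosedIn (ofPrime S N).toSubring F := by
  rw [Subring.isIntegrallyClosedIn_iff]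
  intro y hy
  obtain ⟨g, hg⟩ := hy.exists_multiple_integral_of_isLocalization N.primeCompl
  have h1 : (g : F) * y ∈ S := Subring.isIntegrallyClosedIn_iff.1 ‹_› hg
  have h2 : IsLocalization.mk' (ofPrime S N).toSubring ⟨_, h1⟩ g * algebraMap S _ g =
    algebraMap S _ ⟨_, h1⟩ := IsLocalization.mk'_spec _ _ _
  have h3 := congrArg Subtype.val h2
  have hg0 : ((g : S) : F) ≠ 0 := fun h ↦ g.2 (by
    have : (g : S) = 0 := Subtype.ext h
    rw [this]; exact N.zero_mem)
  have h4 : ((IsLocalization.mk' (ofPrime S N).toSubring ⟨_, h1⟩ g : (ofPrime S N).toSubring) : F)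
      = y := by
    apply mul_right_cancel₀ hg0
    rw [mul_comm y]; exact h3
  rw [← h4]
  exact Subtype.property _

/-- Every `W` containing `S_N` specializes to a valuation ring dominating `S_N`. -/
lemma LocalSubring.exists_le_dominating {R : LocalSubring F} {W : ValuationSubring F}
    (h : R.toSubring ≤ W.toSubring) : ∃ V : ValuationSubring F, V ≤ W ∧ R ≤ V.toLocalSubring := by
  let f : R.toSubring →+* ResidueField W := (residue W).comp (Subring.inclusion h)
  obtain ⟨A, hA, hloc⟩ := IsLocalRing.exists_factor_valuationRing f
  let S : Subring F := (A.toSubring.comap (residue W)).map W.subtype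
  have hS (y : F) : y ∈ S ↔ ∃ hy : y ∈ W, residue W ⟨y, hy⟩ ∈ A := by
    constructor
    · rintro ⟨z, hz, rfl⟩
      exact ⟨z.2, hz⟩
    · rintro ⟨hy, hz⟩
      exact ⟨⟨y, hy⟩, hz, rfl⟩
  let V : ValuationSubring F := ⟨S, fun y ↦ by
    simp only [Subring.mem_carrier, hS]
    by_cases hy0 : y = 0
    · subst hy0
      exact Or.inl ⟨W.zero_mem, (map_zero (residue W)).symm ▸ A.zero_mem⟩
    have key (y : F) (hy0 : y ≠ 0) (hy : y ∈ W) (hn : y⁻¹ ∉ W) : residue W ⟨y, hy⟩ = 0 := by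
      rw [residue_eq_zero_iff, mem_maximalIdeal, mem_nonunits_iff]
      rintro hu
      obtain ⟨z, hz⟩ := isUnit_iff_exists_inv.1 hu
      have : y * z = 1 := congrArg Subtype.val hz
      exact hn (by rw [inv_eq_of_mul_eq_one_right this]; exact z.2)
    by_cases hy : y ∈ W <;> by_cases hy' : y⁻¹ ∈ W
    · have : residue W ⟨y, hy⟩ * residue W ⟨y⁻¹, hy'⟩ = 1 := by
        rw [← map_mul, ← map_one (residue W)]
        exact congrArg _ (Subtype.ext (mul_inv_cancel₀ hy0))
      refine (A.mem_or_inv_mem (residue W ⟨y, hy⟩)).imp (fun h ↦ ⟨hy, h⟩) fun h ↦ ⟨hy', ?_⟩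
      rwa [inv_eq_of_mul_eq_one_right this] at h
    · exact Or.inl ⟨hy, by rw [key y hy0 hy hy']; exact A.zero_mem⟩
    · exact Or.inr ⟨hy', by
        rw [key y⁻¹ (inv_ne_zero hy0) hy' (by rwa [inv_inv])]; exact A.zero_mem⟩
    · exact ((W.mem_or_inv_mem y).elim hy hy').elim⟩
  refine ⟨V, fun y hy ↦ ((hS y).1 hy).1, le_toLocalSubring_iff.2 ⟨fun y hy ↦
    (hS y).2 ⟨h hy, hA ⟨y, hy⟩⟩, fun y hy ↦ ?_⟩⟩
  rw [ValuationSubring.mem_nonunits_iff_or]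
  refine or_iff_not_imp_left.2 fun hy0 hyV ↦ hy ?_
  obtain ⟨hyW, hyA⟩ := (hS _).1 hyV
  refine isUnit_of_map_unit (f.codRestrict A.toSubring hA) y ?_
  refine isUnit_iff_exists_inv.2 ⟨⟨_, hyA⟩, Subtype.ext ?_⟩
  change residue W _ * residue W _ = 1
  rw [← map_mul, ← map_one (residue W)]
  exact congrArg _ (Subtype.ext (mul_inv_cancel₀ hy0))

lemma LocalSubring.mem_radical_map {R : LocalSubring F} {s : Set F}
    (y : Algebra.adjoin R.toSubring s) (h : ∀ V : ValuationSubring F, R ≤ V.toLocalSubring →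
      (∀ a ∈ s, a ∈ V) → (y : F) ∈ V.nonunits) :
    y ∈ ((maximalIdeal R.toSubring).map
      (algebraMap R.toSubring (Algebra.adjoin R.toSubring s))).radical := by
  rw [Ideal.radical_eq_sInf, Ideal.mem_sInf]
  rintro P ⟨hP, hPp⟩
  let S : Subring F := (Algebra.adjoin R.toSubring s).toSubring
  let N : Ideal S := P
  have : N.IsPrime := hPp
  have hRS : R.toSubring ≤ S := fun r hr ↦
    (Algebra.adjoin R.toSubring s).algebraMap_mem ⟨r, hr⟩
  obtain ⟨V, hV⟩ := (ofPrime S N).exists_le_valuationSubring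
  have h1 : R ≤ ofPrime S N := le_ofPrime_of_mem hRS fun y hy ↦ hP (Ideal.mem_map_of_mem _ hy)
  refine (mem_nonunits_iff_of_ofPrime_le hV (y : S)).1 (h V (h1.trans hV) fun a ha ↦ ?_)
  exact hV.1 (le_ofPrime S N (Algebra.subset_adjoin ha))

lemma ValuationSubring.mul_mem_nonunits {V : ValuationSubring F} {a b : F}
    (ha : a ∈ V.nonunits) (hb : b ∈ V) : a * b ∈ V.nonunits := by
  rw [ValuationSubring.mem_nonunits_iff] at ha ⊢
  rw [map_mul]
  exact mul_lt_one_of_lt_of_le ha ((V.valuation_le_one_iff b).2 hb)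

namespace LocalSubring

/-- The valuation rings dominating a local subring. -/
def dominating (R : LocalSubring F) : Set (ValuationSubring F) := {V | R ≤ V.toLocalSubring}

/-- `A` is closed in `R.dominating` for the Zariski topology. -/
def IsClosedIn (R : LocalSubring F) (A : Set (ValuationSubring F)) : Prop :=
  ∀ W ∈ R.dominating, (∀ s : Finset F, (∀ y ∈ s, y ∈ W) → ∃ V ∈ A, ∀ y ∈ s, y ∈ V) → W ∈ A

lemma exists_mem_dominating_ofPrime {R : LocalSubring F} {A : Set (ValuationSubring F)}
    (hA : R.IsClosedIn A) {S : Subring F} {N : Ideal S} [N.IsPrime] (hR : R ≤ ofPrime S N)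
    (h : ∀ g : S, g ∉ N → ∃ V ∈ A, S ≤ V.toSubring ∧ (g : F) ∉ V.nonunits) :
    (A ∩ (ofPrime S N).dominating).Nonempty := by
  let t : {g : S // g ∉ N} → Set (ValuationSubring F) := fun g ↦
    {V | V ∈ A ∧ S ≤ V.toSubring ∧ ((g : S) : F) ∉ V.nonunits}
  have hN1 : (1 : S) ∉ N := fun h ↦ Ideal.IsPrime.ne_top ‹_› ((Ideal.eq_top_iff_one N).2 h)
  have : Nonempty {g : S // g ∉ N} := ⟨⟨1, hN1⟩⟩
  have key {V : ValuationSubring F} (hV : S ≤ V.toSubring) (a b : S)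
      (h : ((a * b : S) : F) ∉ V.nonunits) : (a : F) ∉ V.nonunits := by
    contrapose! h
    exact ValuationSubring.mul_mem_nonunits h (hV b.2)
  obtain ⟨W, hW, hW'⟩ := ValuationSubring.exists_limit t
    (fun a b ↦ ⟨⟨a.1 * b.1, fun h ↦ (Ideal.IsPrime.mem_or_mem ‹_› h).elim a.2 b.2⟩,
      fun V hV ↦ ⟨hV.1, hV.2.1, key hV.2.1 _ _ hV.2.2⟩,
      fun V hV ↦ ⟨hV.1, hV.2.1, key hV.2.1 b.1 a.1 (by rw [mul_comm]; exact hV.2.2)⟩⟩)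
    (fun g ↦ h g.1 g.2)
  have hSW : S ≤ W.toSubring := fun y hy ↦ hW' ⟨1, hN1⟩ y fun V hV ↦ hV.2.1 hy
  have hinv (g : S) (hg : g ∉ N) : (g : F)⁻¹ ∈ W := by
    refine hW' ⟨g, hg⟩ _ fun V hV ↦ ?_
    have := hV.2.2
    rw [ValuationSubring.mem_nonunits_iff_or] at this
    push Not at this
    exact this.2
  have hSN : (ofPrime S N).toSubring ≤ W.toSubring := by
    intro y hy
    obtain ⟨a, g, e⟩ := IsLocalization.exists_mk'_eq N.primeCompl
      (⟨y, hy⟩ : (ofPrime S N).toSubring)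
    have h1 : y * ((g : S) : F) = a := by
      have := IsLocalization.mk'_spec (ofPrime S N).toSubring a g
      rw [e] at this
      exact congrArg Subtype.val this
    have hg0 : ((g : S) : F) ≠ 0 := fun h ↦ g.2 (by
      have : (g : S) = 0 := Subtype.ext h
      rw [this]; exact N.zero_mem)
    rw [(eq_mul_inv_iff_mul_eq₀ hg0).2 h1]
    exact W.mul_mem _ _ (hSW a.2) (hinv g g.2)
  obtain ⟨V, hVW, hV⟩ := exists_le_dominating hSN
  refine ⟨V, hA V (hR.trans hV) fun s hs ↦ ?_, hV⟩
  obtain ⟨V', h1, h2⟩ := hW s (fun y hy ↦ hVW (hs y hy)) ⟨1, hN1⟩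
  exact ⟨V', h1.1, h2⟩

lemma _root_.Algebra.adjoin_subring_le {R V : Subring F} {s : Set F} (hR : R ≤ V)
    (hs : ∀ y ∈ s, y ∈ V) : (Algebra.adjoin R s).toSubring ≤ V := fun y hy ↦ by
  refine Algebra.adjoin_induction (p := fun y _ ↦ y ∈ V) hs (fun r ↦ hR r.2)
    (fun _ _ _ _ ↦ V.add_mem) (fun _ _ _ _ ↦ V.mul_mem) hy

lemma _root_.ValuationSubring.mem_of_isIntegral_adjoin {R : Subring F} {V : ValuationSubring F}
    {s : Set F} {y : F} (hR : R ≤ V.toSubring) (hs : ∀ y ∈ s, y ∈ V)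
    (hy : IsIntegral (Algebra.adjoin R s) y) : y ∈ V := by
  have : IsIntegrallyClosedIn V.toSubring F := inferInstanceAs (IsIntegrallyClosedIn V F)
  exact (Subring.integralClosure_subring_le_iff (S := (Algebra.adjoin R s).toSubring)).2
    (Algebra.adjoin_subring_le hR hs) hy

lemma exists_separating {R : LocalSubring F} {A B : Set (ValuationSubring F)} {x : F}
    (hAR : A ⊆ R.dominating) (hBR : B ⊆ R.dominating)
    (hA : R.IsClosedIn A) (hB : R.IsClosedIn B)
    (hmax : ∀ R' : LocalSubring F, R ≤ R' → IsIntegrallyClosedIn R'.toSubring F →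
      (A ∩ R'.dominating).Nonempty → (B ∩ R'.dominating).Nonempty → R'.toSubring ≤ R.toSubring)
    (hx : x ∉ R.toSubring) :
    ∃ e : F, IsIntegral (Algebra.adjoin R.toSubring {x}) e ∧
      (∀ V ∈ A, x ∈ V → e ∈ V.nonunits) ∧ ∀ V ∈ B, x ∈ V → 1 - e ∈ V.nonunits := by
  let S₀ := Algebra.adjoin R.toSubring {x}
  let S : Subring F := (integralClosure S₀ F).toSubring
  have hS₀S : S₀.toSubring ≤ S := fun y hy ↦ (isIntegral_algebraMap (x := (⟨y, hy⟩ : S₀)))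
  have : IsIntegrallyClosedIn S F := inferInstanceAs
    (IsIntegrallyClosedIn (integralClosure S₀ F) F)
  have hRS : R.toSubring ≤ S := fun y hy ↦ hS₀S (S₀.algebraMap_mem ⟨y, hy⟩)
  have hxS : x ∈ S := hS₀S (Algebra.subset_adjoin rfl)
  have hSV {V : ValuationSubring F} (hV : V ∈ R.dominating) (hxV : x ∈ V) : S ≤ V.toSubring :=
    fun y hy ↦ ValuationSubring.mem_of_isIntegral_adjoin hV.1 (by simpa using hxV) hy
  let I (A : Set (ValuationSubring F)) (hAR : A ⊆ R.dominating) : Ideal S :=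
    { carrier := {y | ∀ V ∈ A, x ∈ V → (y : F) ∈ V.nonunits}
      zero_mem' := fun V _ _ ↦ V.nonunits.zero_mem
      add_mem' := fun ha hb V hV hx ↦ V.nonunits.add_mem (ha V hV hx) (hb V hV hx)
      smul_mem' := fun c y hy V hV hx ↦ by
        rw [smul_eq_mul, mul_comm]
        exact ValuationSubring.mul_mem_nonunits (hy V hV hx) (hSV (hAR hV) hx c.2) }
  by_cases htop : I A hAR ⊔ I B hBR = ⊤
  · obtain ⟨e, he, f, hf, hef⟩ := Submodule.mem_sup.1 ((Ideal.eq_top_iff_one _).1 htop)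
    refine ⟨e, e.2, he, ?_⟩
    have : (1 : F) - e = f := by
      rw [sub_eq_iff_eq_add, add_comm]; exact (congrArg Subtype.val hef).symm
    rw [this]
    exact hf
  obtain ⟨N, hN, hle⟩ := Ideal.exists_le_maximal _ htop
  have hNA (A : Set (ValuationSubring F)) (hAR : A ⊆ R.dominating) (hA : I A hAR ≤ N) (g : S)
      (hg : g ∉ N) : ∃ V ∈ A, S ≤ V.toSubring ∧ (g : F) ∉ V.nonunits := by
    by_contra! hcon
    exact hg (hA fun V hV hxV ↦ hcon V hV (hSV (hAR hV) hxV))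
  have hRN : R ≤ ofPrime S N := le_ofPrime_of_mem hRS fun y hy ↦
    hle (Ideal.mem_sup_left fun V hV _ ↦ (le_toLocalSubring_iff.1 (hAR hV)).2 y hy)
  refine (hx (hmax (ofPrime S N) hRN (isIntegrallyClosedIn_ofPrime S N) ?_ ?_
    (le_ofPrime S N hxS))).elim
  · exact exists_mem_dominating_ofPrime hA hRN (hNA A hAR (le_sup_left.trans hle))
  · exact exists_mem_dominating_ofPrime hB hRN (hNA B hBR (le_sup_right.trans hle))

lemma exists_mem_dominating_inv_mem {R : LocalSubring F} [IsIntegrallyClosedIn R.toSubring F]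
    {x : F} (hx : x ∉ R.toSubring) (hx' : x⁻¹ ∉ R.toSubring) :
    ∃ V ∈ R.dominating, x ∈ V ∧ x⁻¹ ∈ V := by
  by_contra! hcon
  obtain ⟨V, hV, hxV⟩ := exists_le_valuationSubring_of_isIntegrallyClosedIn hx
  obtain ⟨V', hV', hxV'⟩ := exists_le_valuationSubring_of_isIntegrallyClosedIn hx'
  have hx0 : x ≠ 0 := by rintro rfl; exact hx R.toSubring.zero_mem
  have h1 (V : ValuationSubring F) (hV : x ∉ V) : (1 + x)⁻¹ ∈ V.nonunits := by
    rw [ValuationSubring.mem_nonunits_iff_or, inv_inv]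
    exact Or.inr fun h ↦ hV (by simpa using V.toSubring.sub_mem h V.one_mem)
  have h2 (V : ValuationSubring F) (hV : x⁻¹ ∉ V) : (1 + x)⁻¹ ∈ V ∧ (1 + x)⁻¹ ∉ V.nonunits := by
    have hxn : x ∈ V.nonunits := by
      rw [ValuationSubring.mem_nonunits_iff_or]; exact Or.inr hV
    have h3 : 1 + x ∉ V.nonunits := fun h ↦ by
      have := V.nonunits.sub_mem h hxn
      rw [add_sub_cancel_right] at this
      exact absurd this (by simp [ValuationSubring.mem_nonunits_iff])
    constructor
    · rw [ValuationSubring.mem_nonunits_iff_or] at h3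
      push Not at h3
      exact h3.2
    · rw [ValuationSubring.mem_nonunits_iff_or, inv_inv]
      push Not
      refine ⟨inv_ne_zero ?_, V.add_mem _ _ V.one_mem (V.nonunits_subset hxn)⟩
      rintro h0
      rw [h0] at h3
      exact h3 V.nonunits.zero_mem
  have hyR : (1 + x)⁻¹ ∈ R.toSubring := by
    by_contra hy
    obtain ⟨W, hW, hyW⟩ := exists_le_valuationSubring_of_isIntegrallyClosedIn hy
    by_cases h : x ∈ W
    · exact hyW (h2 W (hcon W hW h)).1
    · exact hyW (W.nonunits_subset (h1 W h))
  exact (h2 V' hxV').2 ((le_toLocalSubring_iff.1 hV').2 _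
    (mem_maximalIdeal_of_mem_nonunits (y := ⟨_, hyR⟩) hV (h1 V hxV)))

end LocalSubring

lemma isIntegral_of_coeff_mem {B K : Type*} [CommRing B] [Field K] [Algebra B K] {p : K[X]}
    (hp : p.Monic) (hc : ∀ i < p.natDegree, p.coeff i ∈ (algebraMap B K).range) {y : K}
    (hy : p.eval y = 0) : IsIntegral B y := by
  have hl : p ∈ lifts (algebraMap B K) := by
    rw [lifts_iff_coeff_lifts]
    intro i
    rcases lt_trichotomy i p.natDegree with hi | rfl | hi
    · exact hc i hi
    · rw [hp.coeff_natDegree]; exact ⟨1, map_one _⟩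
    · rw [coeff_eq_zero_of_natDegree_lt hi]; exact ⟨0, map_zero _⟩
  obtain ⟨q, hq, -, hq'⟩ := lifts_and_natDegree_eq_and_monic hl hp
  exact ⟨q, hq', by rw [eval₂_eq_eval_map, hq, hy]⟩

lemma Subalgebra.coe_mem_smul_iff {A : Subring F} (I : Ideal A) (T : Subalgebra A F) (y : T) :
    (y : F) ∈ I • T.toSubmodule ↔ y ∈ I.map (algebraMap A T) := by
  have h1 : I • T.toSubmodule = (I • (⊤ : Submodule A T)).map T.val.toLinearMap := by
    rw [Submodule.map_smul'', Submodule.map_top]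
    congr 1
    ext z
    simp
  rw [h1, Ideal.smul_top_eq_map]
  constructor
  · rintro ⟨z, hz, hzy⟩
    rwa [← Subtype.ext hzy]
  · exact fun h ↦ ⟨y, h, rfl⟩

/-- If `e` and `e'` are idempotent and agree up to radical of `J`, they can be replaced by
elements congruent modulo `J`. -/
lemma Ideal.exists_aeval_sub_mem {T : Type*} [CommRing T] (J : Ideal T) {e e' : T}
    (h : e * (1 - e) ∈ J.radical) (h' : e' * (1 - e') ∈ J.radical) (hw : e - e' ∈ J.radical) :
    ∃ p : ℤ[X], X * (1 - X) ∣ p - X ∧ aeval e p - aeval e' p ∈ J := by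
  obtain ⟨n, hn⟩ := h
  obtain ⟨n', hn'⟩ := h'
  obtain ⟨p, hp, hpX⟩ := Polynomial.exists_approx_idempotent (n + n')
  refine ⟨p, hpX, ?_⟩
  have hid {f : T} (hf : (f * (1 - f)) ^ (n + n') ∈ J) :
      IsIdempotentElem (Ideal.Quotient.mk J (aeval f p)) := by
    have h1 : aeval f p * (1 - aeval f p) ∈ J := by
      obtain ⟨q, hq⟩ := hp
      have := congrArg (aeval f) hq
      simp only [map_mul, map_sub, map_one, map_pow, aeval_X] at this
      rw [this]
      exact J.mul_mem_right _ hf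
    rw [IsIdempotentElem, ← map_mul, Ideal.Quotient.mk_eq_mk_iff_sub_mem]
    rw [← neg_mem_iff]
    convert h1 using 1
    ring
  have hrad {f : T} (hf : f * (1 - f) ∈ J.radical) : aeval f p - f ∈ J.radical := by
    obtain ⟨q, hq⟩ := hpX
    have := congrArg (aeval f) hq
    simp only [map_mul, map_sub, map_one, aeval_X] at this
    rw [this]
    exact J.radical.mul_mem_right _ hf
  rw [← Ideal.Quotient.mk_eq_mk_iff_sub_mem]
  refine eq_of_isNilpotent_sub_of_isIdempotentElem
    (hid (by rw [pow_add]; exact J.mul_mem_right _ hn))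
    (hid (by rw [pow_add]; exact J.mul_mem_left _ hn')) ?_
  rw [← map_sub]
  have : aeval e p - aeval e' p ∈ J.radical := by
    have := J.radical.add_mem (J.radical.sub_mem (hrad ⟨n, hn⟩) (hrad ⟨n', hn'⟩)) hw
    convert this using 1
    ring
  obtain ⟨k, hk⟩ := this
  exact ⟨k, by rw [← map_pow]; exact Ideal.Quotient.eq_zero_iff_mem.2 hk⟩

/-- The elements lying in every valuation ring that contains `A` and `x`. -/
def Subring.valuationInter (A : Subring F) (x : F) : Subalgebra A F where
  carrier := {y | ∀ V : ValuationSubring F, A ≤ V.toSubring → x ∈ V → y ∈ V}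
  mul_mem' ha hb V hV hx := V.mul_mem _ _ (ha V hV hx) (hb V hV hx)
  add_mem' ha hb V hV hx := V.add_mem _ _ (ha V hV hx) (hb V hV hx)
  algebraMap_mem' r _ hV _ := hV r.2

namespace Subring
variable {A : Subring F} {x : F}

lemma self_mem_valuationInter : x ∈ A.valuationInter x := fun _ _ h ↦ h

lemma mem_valuationInter_of_isIntegral {e : F} (he : IsIntegral (Algebra.adjoin A {x}) e) :
    e ∈ A.valuationInter x := fun V hV hx ↦
  ValuationSubring.mem_of_isIntegral_adjoin hV (by simpa using hx) he

/-- `y` has a pole of bounded order along `x = 0` and along `x = ∞`. -/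
def IsBounded (A : Subring F) (x y : F) : Prop :=
  ∃ c : ℕ, ∀ k ≥ c, x ^ k * y ∈ A.valuationInter x ∧ x⁻¹ ^ k * y ∈ A.valuationInter x⁻¹

lemma IsBounded.inv {y : F} (h : A.IsBounded x y) : A.IsBounded x⁻¹ y := by
  obtain ⟨c, hc⟩ := h
  exact ⟨c, fun k hk ↦ ⟨(hc k hk).2, by rw [inv_inv]; exact (hc k hk).1⟩⟩

lemma IsBounded.add {y z : F} (hy : A.IsBounded x y) (hz : A.IsBounded x z) :
    A.IsBounded x (y + z) := by
  obtain ⟨c, hc⟩ := hy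
  obtain ⟨d, hd⟩ := hz
  refine ⟨c + d, fun k hk ↦ ?_⟩
  simp only [mul_add]
  exact ⟨add_mem (hc k (by omega)).1 (hd k (by omega)).1,
    add_mem (hc k (by omega)).2 (hd k (by omega)).2⟩

lemma IsBounded.mul {y z : F} (hy : A.IsBounded x y) (hz : A.IsBounded x z) :
    A.IsBounded x (y * z) := by
  obtain ⟨c, hc⟩ := hy
  obtain ⟨d, hd⟩ := hz
  refine ⟨c + d, fun k hk ↦ ?_⟩
  obtain ⟨l, rfl⟩ := Nat.exists_eq_add_of_le hk
  have (t : F) : t ^ (c + d + l) * (y * z) = (t ^ (c + l) * y) * (t ^ d * z) := by ring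
  simp only [this]
  exact ⟨mul_mem (hc _ (by omega)).1 (hd d le_rfl).1, mul_mem (hc _ (by omega)).2 (hd d le_rfl).2⟩

lemma isBounded_of_mem {y : F} (hy : y ∈ A) : A.IsBounded x y :=
  ⟨0, fun k _ ↦ ⟨mul_mem (pow_mem self_mem_valuationInter k) (fun _ hV _ ↦ hV hy),
    mul_mem (pow_mem self_mem_valuationInter k) (fun _ hV _ ↦ hV hy)⟩⟩

lemma isBounded_self : A.IsBounded x x := by
  refine ⟨1, fun k hk ↦ ⟨mul_mem (pow_mem self_mem_valuationInter k) self_mem_valuationInter, ?_⟩⟩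
  by_cases hx : x = 0
  · rw [hx, mul_zero]; exact zero_mem _
  · obtain ⟨l, rfl⟩ := Nat.exists_eq_add_of_le' hk
    rw [pow_succ, inv_mul_cancel_right₀ hx]
    exact pow_mem self_mem_valuationInter l

lemma isBounded_of_mem_adjoin {s : Set F} (hs : ∀ y ∈ s, A.IsBounded x y) {y : F}
    (hy : y ∈ Algebra.adjoin A s) : A.IsBounded x y := by
  refine Algebra.adjoin_induction (p := fun y _ ↦ A.IsBounded x y) hs
    (fun r ↦ isBounded_of_mem r.2) (fun _ _ _ _ ↦ IsBounded.add) (fun _ _ _ _ ↦ IsBounded.mul) hy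

lemma isBounded_of_isIntegral {e : F} (he : IsIntegral (Algebra.adjoin A {x}) e) :
    A.IsBounded x e := by
  obtain ⟨p, hp, hpe⟩ := he
  have hb (i : ℕ) : A.IsBounded x (p.coeff i : F) :=
    isBounded_of_mem_adjoin (by rintro y rfl; exact isBounded_self) (p.coeff i).2
  choose c hc using hb
  refine ⟨∑ i ∈ Finset.range p.natDegree, c i, fun k hk ↦
    ⟨mul_mem (pow_mem self_mem_valuationInter k) (mem_valuationInter_of_isIntegral ⟨p, hp, hpe⟩),
      fun V hV hx ↦ ?_⟩⟩
  let q : F[X] := (p.map (algebraMap _ F)).scaleRoots (x⁻¹ ^ k)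
  have hp' : (p.map (algebraMap (Algebra.adjoin A {x}) F)).Monic := hp.map _
  have hq : q.Monic := (monic_scaleRoots_iff _).2 hp'
  have hqe : aeval (x⁻¹ ^ k * e) q = 0 := by
    refine scaleRoots_aeval_eq_zero (A := F) ?_
    rw [aeval_map_algebraMap, aeval_def]; exact hpe
  rw [coe_aeval_eq_eval] at hqe
  have : IsIntegral V (x⁻¹ ^ k * e) := by
    refine isIntegral_of_coeff_mem hq (fun i hi ↦ ?_) hqe
    suffices q.coeff i ∈ V from ⟨⟨_, this⟩, rfl⟩
    rw [natDegree_scaleRoots, hp.natDegree_map] at hi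
    simp only [q, coeff_scaleRoots, hp.natDegree_map, coeff_map]
    obtain ⟨d, hd⟩ := Nat.exists_eq_add_of_lt hi
    rw [← pow_mul, mul_comm]
    refine (hc i _ ?_).2 V hV hx
    have h1 : c i ≤ ∑ i ∈ Finset.range p.natDegree, c i :=
      Finset.single_le_sum (f := c) (fun _ _ ↦ Nat.zero_le _) (Finset.mem_range.2 hi)
    exact (h1.trans hk).trans (Nat.le_mul_of_pos_right _ (by omega))
  obtain ⟨z, hz⟩ := IsIntegrallyClosed.isIntegral_iff.1 this
  rw [← hz]
  exact z.2

/-- `A[x, x⁻¹]`-modules of finite type are spanned over `A` by the `x ^ k * g`. -/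
lemma exists_adjoin_le_span {e e' : F} (hx : x ≠ 0) (he : IsIntegral (Algebra.adjoin A {x}) e)
    (he' : IsIntegral (Algebra.adjoin A {x⁻¹}) e') :
    ∃ G : Finset F, (∀ g ∈ G, g ∈ Algebra.adjoin A {x, x⁻¹, e, e'}) ∧
      (Algebra.adjoin A {x, x⁻¹, e, e'}).toSubmodule ≤
        Submodule.span A {y | ∃ (k : ℤ), ∃ g ∈ G, y = x ^ k * g} := by
  let L := Algebra.adjoin A {x, x⁻¹}
  have hint {s : Set F} {f : F} (hs : s ⊆ {x, x⁻¹}) (hf : IsIntegral (Algebra.adjoin A s) f) :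
      IsIntegral L f := by
    obtain ⟨p, hp, hpf⟩ := hf
    refine ⟨p.map (Subalgebra.inclusion (Algebra.adjoin_mono hs)).toRingHom, hp.map _, ?_⟩
    rw [eval₂_map]
    exact hpf
  have hfg : (Algebra.adjoin L {e, e'}).toSubmodule.FG := by
    refine fg_adjoin_of_finite (Set.toFinite _) ?_
    rintro f (rfl | rfl)
    · exact hint (by simp) he
    · exact hint (by simp) he'
  have heq : Algebra.adjoin A {x, x⁻¹, e, e'} = (Algebra.adjoin L {e, e'}).restrictScalars A := by
    rw [← Algebra.adjoin_union_eq_adjoin_adjoin]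
    congr 1
    ext; simp; tauto
  obtain ⟨G, hG⟩ := hfg
  have hGmem (g : F) : g ∈ Submodule.span L (G : Set F) ↔
      g ∈ Algebra.adjoin A {x, x⁻¹, e, e'} := by rw [hG, heq]; rfl
  refine ⟨G, fun g hg ↦ (hGmem g).1 (Submodule.subset_span hg), fun y hy ↦ ?_⟩
  set M := Submodule.span A {y | ∃ (k : ℤ), ∃ g ∈ G, y = x ^ k * g}
  have hzpow (k : ℤ) (z : F) (hz : z ∈ M) : x ^ k * z ∈ M := by
    induction hz using Submodule.span_induction with
    | mem z h =>
      obtain ⟨l, g, hg, rfl⟩ := h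
      exact Submodule.subset_span ⟨k + l, g, hg, by rw [zpow_add₀ hx, mul_assoc]⟩
    | zero => rw [mul_zero]; exact zero_mem _
    | add a b _ _ ha hb => rw [mul_add]; exact add_mem ha hb
    | smul a b _ hb => rw [mul_smul_comm]; exact M.smul_mem _ hb
  have hL (l : F) (hl : l ∈ L) : ∀ z ∈ M, l * z ∈ M := by
    induction hl using Algebra.adjoin_induction with
    | mem l hl =>
      intro z hz
      rcases hl with rfl | rfl
      · simpa using hzpow 1 z hz
      · simpa using hzpow (-1) z hz
    | algebraMap r => exact fun z hz ↦ M.smul_mem r hz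
    | add a b _ _ ha hb => exact fun z hz ↦ by rw [add_mul]; exact add_mem (ha z hz) (hb z hz)
    | mul a b _ _ ha hb => exact fun z hz ↦ by rw [mul_assoc]; exact ha _ (hb z hz)
  have hy' := (hGmem y).2 hy
  induction hy' using Submodule.span_induction with
  | mem g hg => exact Submodule.subset_span ⟨0, g, hg, by simp⟩
  | zero => exact zero_mem _
  | add a b ha hb ha' hb' => exact add_mem (ha' ((hGmem a).1 ha)) (hb' ((hGmem b).1 hb))
  | smul a b hb hb' => exact hL a a.2 _ (hb' ((hGmem b).1 hb))

lemma exists_adjoin_le_sup {e e' : F} (hx : x ≠ 0) (he : IsIntegral (Algebra.adjoin A {x}) e)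
    (he' : IsIntegral (Algebra.adjoin A {x⁻¹}) e') :
    ∃ T₀ : Submodule A F, T₀.FG ∧ (Algebra.adjoin A {x, x⁻¹, e, e'}).toSubmodule ≤
      (Algebra.adjoin A {x, x⁻¹, e, e'} ⊓ A.valuationInter x).toSubmodule ⊔
      (Algebra.adjoin A {x, x⁻¹, e, e'} ⊓ A.valuationInter x⁻¹).toSubmodule ⊔ T₀ := by
  obtain ⟨G, hGT, hG⟩ := exists_adjoin_le_span hx he he'
  set T := Algebra.adjoin A {x, x⁻¹, e, e'}
  have hb (g : F) (hg : g ∈ T) : A.IsBounded x g := by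
    refine isBounded_of_mem_adjoin ?_ hg
    have h1 := (isBounded_self (A := A) (x := x⁻¹)).inv
    have h2 := (isBounded_of_isIntegral he').inv
    rw [inv_inv] at h1 h2
    rintro y (rfl | rfl | rfl | rfl)
    · exact isBounded_self
    · exact h1
    · exact isBounded_of_isIntegral he
    · exact h2
  choose! c hc using hb
  let n : ℤ := ∑ g ∈ G, (c g : ℤ)
  have hn (g : F) (hg : g ∈ G) : (c g : ℤ) ≤ n :=
    Finset.single_le_sum (f := fun g ↦ (c g : ℤ)) (fun _ _ ↦ by positivity) hg
  have hxT : x ∈ T := Algebra.subset_adjoin (by simp)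
  have hxT' : x⁻¹ ∈ T := Algebra.subset_adjoin (by simp)
  let T₀ : Submodule A F := Submodule.span A ((fun z : ℤ × F ↦ x ^ z.1 * z.2) ''
    (Finset.Icc (-n) n ×ˢ G : Finset (ℤ × F)))
  refine ⟨T₀, Submodule.fg_span ((Finset.finite_toSet _).image _), hG.trans ?_⟩
  rw [Submodule.span_le]
  rintro _ ⟨k, g, hg, rfl⟩
  have hcg := hn g hg
  by_cases hk : n < k
  · lift k to ℕ using by omega
    rw [zpow_natCast]
    exact Submodule.mem_sup_left (Submodule.mem_sup_left
      ⟨mul_mem (pow_mem hxT k) (hGT g hg), (hc g (hGT g hg) k (by omega)).1⟩)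
  by_cases hk' : k < -n
  · obtain ⟨l, rfl⟩ : ∃ l : ℤ, k = -l := ⟨-k, by simp⟩
    lift l to ℕ using by omega
    rw [zpow_neg, zpow_natCast, ← inv_pow]
    exact Submodule.mem_sup_left (Submodule.mem_sup_right
      ⟨mul_mem (pow_mem hxT' l) (hGT g hg), (hc g (hGT g hg) l (by omega)).2⟩)
  · refine Submodule.mem_sup_right (Submodule.subset_span ⟨(k, g), ?_, rfl⟩)
    simp only [Finset.coe_product, Set.mem_prod, Finset.mem_coe, Finset.mem_Icc]
    exact ⟨⟨by omega, by omega⟩, hg⟩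

lemma exists_glue_of_isNoetherian [IsNoetherianRing A] (I : Ideal A) {e e' : F} (hx : x ≠ 0)
    (he : IsIntegral (Algebra.adjoin A {x}) e) (he' : IsIntegral (Algebra.adjoin A {x⁻¹}) e')
    {n : ℕ}
    (hu : (e * (1 - e)) ^ n ∈ I • (Algebra.adjoin A {x, x⁻¹, e, e'}).toSubmodule)
    (hu' : (e' * (1 - e')) ^ n ∈ I • (Algebra.adjoin A {x, x⁻¹, e, e'}).toSubmodule)
    (hw : (e - e') ^ n ∈ I • (Algebra.adjoin A {x, x⁻¹, e, e'}).toSubmodule) :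
    ∃ r ∈ A.valuationInter x ⊓ A.valuationInter x⁻¹, ∀ V : ValuationSubring F,
      A ≤ V.toSubring → (∀ y ∈ I, (y : F) ∈ V.nonunits) → x ∈ V → e * (1 - e) ∈ V.nonunits →
      e - r ∈ V.nonunits := by
  obtain ⟨T₀, hT₀, hle⟩ := exists_adjoin_le_sup hx he he'
  set T := Algebra.adjoin A {x, x⁻¹, e, e'}
  obtain ⟨N, hN⟩ := I.exists_sub_mem_smul (T ⊓ A.valuationInter x).toSubmodule
    (T ⊓ A.valuationInter x⁻¹).toSubmodule T₀ hT₀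
  have heT : e ∈ T := Algebra.subset_adjoin (by simp)
  have heT' : e' ∈ T := Algebra.subset_adjoin (by simp)
  let f : T := ⟨e, heT⟩
  let f' : T := ⟨e', heT'⟩
  let J : Ideal T := (I ^ N).map (algebraMap A T)
  have hJ (y : T) (hy : ((y ^ n : T) : F) ∈ I • T.toSubmodule) : y ∈ J.radical := by
    rw [Subalgebra.coe_mem_smul_iff] at hy
    refine ⟨n * N, ?_⟩
    rw [pow_mul]
    simp only [J, Ideal.map_pow]
    exact Ideal.pow_mem_pow hy N
  obtain ⟨p, hpX, hp⟩ := J.exists_aeval_sub_mem (e := f) (e' := f')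
    (hJ _ (by simpa [f] using hu)) (hJ _ (by simpa [f'] using hu'))
    (hJ _ (by simpa [f, f'] using hw))
  have hcoe {B : Subalgebra A F} (g : B) : ((aeval g p : B) : F) = aeval (g : F) p :=
    (aeval_algHom_apply (B.val.restrictScalars ℤ) g p).symm
  have hmem {B : Subalgebra A F} {g : F} (hg : g ∈ B) : aeval g p ∈ B := by
    have := (aeval (⟨g, hg⟩ : B) p).2
    rwa [hcoe] at this
  have hsub : aeval e p - aeval e' p ∈ I ^ N • T.toSubmodule := by
    have := (Subalgebra.coe_mem_smul_iff (I ^ N) T _).2 hp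
    rwa [Subalgebra.coe_sub, hcoe, hcoe] at this
  obtain ⟨r, ⟨hrS, hrS'⟩, hr⟩ := hN _ ⟨hmem heT, hmem (mem_valuationInter_of_isIntegral he)⟩ _
    ⟨hmem heT', hmem (mem_valuationInter_of_isIntegral he')⟩ (Submodule.smul_mono le_rfl hle hsub)
  refine ⟨r, ⟨hrS.2, hrS'.2⟩, fun V hV hI hxV hu ↦ ?_⟩
  have h1 : aeval e p - r ∈ V.nonunits := by
    refine Submodule.smul_induction_on (p := (· ∈ V.nonunits)) hr (fun y hy z hz ↦ ?_)
      fun _ _ ↦ V.nonunits.add_mem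
    exact ValuationSubring.mul_mem_nonunits (hI y hy) (hz.2 V hV hxV)
  have h2 : aeval e p - e ∈ V.nonunits := by
    obtain ⟨q, hq⟩ := hpX
    have := congrArg (aeval e) hq
    simp only [map_mul, map_sub, map_one, aeval_X] at this
    rw [this]
    have heV : e ∈ V := mem_valuationInter_of_isIntegral he V hV hxV
    refine ValuationSubring.mul_mem_nonunits hu ?_
    have := aeval_algHom_apply (V.toSubring.subtype.toIntAlgHom) ⟨e, heV⟩ q
    change aeval e q = _ at this
    rw [this]
    exact Subtype.property _
  have : e - r = (aeval e p - r) - (aeval e p - e) := by ring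
  rw [this]
  exact V.nonunits.sub_mem h1 h2

end Subring

section

open Filter

namespace Subring
variable {R : Subring F}

/-- The subring generated by a finite set of elements of `R`. -/
def generatedBy (t : Finset R) : Subring F := closure (Subtype.val '' (t : Set R))

lemma generatedBy_le (t : Finset R) : generatedBy t ≤ R :=
  closure_le.2 (by rintro _ ⟨y, -, rfl⟩; exact y.2)

instance (t : Finset R) : IsNoetherianRing (generatedBy t) :=
  is_noetherian_subring_closure _ (t.finite_toSet.image _)

lemma eventually_mem_generatedBy (r : R) : ∀ᶠ t : Finset R in atTop, (r : F) ∈ generatedBy t := by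
  filter_upwards [eventually_ge_atTop {r}] with t ht
  exact subset_closure ⟨r, by simpa using ht, rfl⟩

lemma eventually_mem_adjoin {s : Set F} {a : F} (ha : a ∈ Algebra.adjoin R s) :
    ∀ᶠ t : Finset R in atTop, a ∈ Algebra.adjoin (generatedBy t) s := by
  induction ha using Algebra.adjoin_induction with
  | mem a ha => exact .of_forall fun t ↦ Algebra.subset_adjoin ha
  | algebraMap r =>
    filter_upwards [eventually_mem_generatedBy r] with t ht
    exact (Algebra.adjoin (generatedBy t) s).algebraMap_mem ⟨_, ht⟩
  | add a b _ _ ha hb => filter_upwards [ha, hb] with t ha hb using add_mem ha hb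
  | mul a b _ _ ha hb => filter_upwards [ha, hb] with t ha hb using mul_mem ha hb

lemma eventually_mem_smul {s : Set F} {I : Ideal R} {z : Algebra.adjoin R s}
    (hz : z ∈ I.map (algebraMap R (Algebra.adjoin R s))) :
    ∀ᶠ t : Finset R in atTop, (z : F) ∈ I.comap (inclusion (generatedBy_le t)) •
      (Algebra.adjoin (generatedBy t) s).toSubmodule := by
  induction hz using Submodule.span_induction with
  | mem z hz =>
    obtain ⟨r, hr, rfl⟩ := hz
    filter_upwards [eventually_mem_generatedBy r] with t ht
    have := Submodule.smul_mem_smul (I := I.comap (inclusion (generatedBy_le t))) (r := ⟨r, ht⟩)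
      hr ((Subalgebra.mem_toSubmodule _).2 (one_mem (Algebra.adjoin (generatedBy t) s)))
    convert this using 1
    exact (mul_one _).symm
  | zero => exact .of_forall fun t ↦ zero_mem _
  | add a b _ _ ha hb => filter_upwards [ha, hb] with t ha hb using add_mem ha hb
  | smul c z _ hz =>
    filter_upwards [hz, eventually_mem_adjoin c.2] with t hz hc
    refine Submodule.smul_induction_on (p := fun z ↦ (c : F) * z ∈ _) hz (fun r hr y hy ↦ ?_)
      fun a b ha hb ↦ by rw [mul_add]; exact add_mem ha hb
    rw [mul_smul_comm]
    exact Submodule.smul_mem_smul hr ((Subalgebra.mem_toSubmodule _).2 (mul_mem hc hy))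

lemma eventually_isIntegral {s : Set F} {e : F} (he : IsIntegral (Algebra.adjoin R s) e) :
    ∀ᶠ t : Finset R in atTop, IsIntegral (Algebra.adjoin (generatedBy t) s) e := by
  obtain ⟨p, hp, hpe⟩ := he
  have : ∀ᶠ t : Finset R in atTop, ∀ i ∈ Finset.range p.natDegree,
      (p.coeff i : F) ∈ Algebra.adjoin (generatedBy t) s :=
    (eventually_all_finset _).2 fun i _ ↦ eventually_mem_adjoin (p.coeff i).2
  filter_upwards [this] with t ht
  refine isIntegral_of_coeff_mem (hp.map (algebraMap _ F)) (fun i hi ↦ ?_)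
    (by rw [← eval₂_eq_eval_map]; exact hpe)
  rw [hp.natDegree_map] at hi
  rw [coeff_map]
  exact ⟨⟨_, ht i (Finset.mem_range.2 hi)⟩, rfl⟩

end Subring

namespace LocalSubring

lemma exists_glue {R : LocalSubring F} [IsIntegrallyClosedIn R.toSubring F] {x e e' : F}
    (hx : x ≠ 0) (he : IsIntegral (Algebra.adjoin R.toSubring {x}) e)
    (he' : IsIntegral (Algebra.adjoin R.toSubring {x⁻¹}) e')
    (h : ∀ V ∈ R.dominating, x ∈ V → x⁻¹ ∈ V →
      e * (1 - e) ∈ V.nonunits ∧ e' * (1 - e') ∈ V.nonunits ∧ e - e' ∈ V.nonunits) :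
    ∃ r ∈ R.toSubring, ∀ V ∈ R.dominating, x ∈ V → e * (1 - e) ∈ V.nonunits →
      e - r ∈ V.nonunits := by
  set T := Algebra.adjoin R.toSubring {x, x⁻¹, e, e'}
  let m := (maximalIdeal R.toSubring).map (algebraMap R.toSubring T)
  have heT : e ∈ T := Algebra.subset_adjoin (by simp)
  have heT' : e' ∈ T := Algebra.subset_adjoin (by simp)
  let f : T := ⟨e, heT⟩
  let f' : T := ⟨e', heT'⟩
  have hmem {y : T} (hy : ∀ V ∈ R.dominating, x ∈ V → x⁻¹ ∈ V → (y : F) ∈ V.nonunits) :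
      y ∈ m.radical := mem_radical_map y fun V hV hs ↦
    hy V hV (hs _ (by simp)) (hs _ (by simp))
  obtain ⟨n₁, h₁⟩ := hmem (y := f * (1 - f)) fun V hV hx hx' ↦ (h V hV hx hx').1
  obtain ⟨n₂, h₂⟩ := hmem (y := f' * (1 - f')) fun V hV hx hx' ↦ (h V hV hx hx').2.1
  obtain ⟨n₃, h₃⟩ := hmem (y := f - f') fun V hV hx hx' ↦ (h V hV hx hx').2.2
  have key {y : T} {k : ℕ} (hk : y ^ k ∈ m) (hkn : k ≤ n₁ + n₂ + n₃) :=
    Subring.eventually_mem_smul (m.mem_of_dvd (pow_dvd_pow y hkn) hk)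
  obtain ⟨t, he, he', h₁, h₂, h₃⟩ := ((Subring.eventually_isIntegral he).and <|
    (Subring.eventually_isIntegral he').and <| (key h₁ (by omega)).and <|
    (key h₂ (by omega)).and (key h₃ (by omega))).exists
  obtain ⟨r, hr, hr'⟩ := Subring.exists_glue_of_isNoetherian _ hx he he' h₁ h₂ h₃
  have hle := Subring.generatedBy_le t
  refine ⟨r, ?_, fun V hV ↦ hr' V (hle.trans hV.1) fun y hy ↦
    (le_toLocalSubring_iff.1 hV).2 _ hy⟩
  by_contra hrR
  obtain ⟨V, hV, hrV⟩ := exists_le_valuationSubring_of_isIntegrallyClosedIn hrR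
  exact hrV ((V.mem_or_inv_mem x).elim (hr.1 V (hle.trans hV.1)) (hr.2 V (hle.trans hV.1)))

end LocalSubring

end

lemma ValuationSubring.one_notMem_nonunits (V : ValuationSubring F) : 1 ∉ V.nonunits := by
  simp [ValuationSubring.mem_nonunits_iff]

namespace LocalSubring

section Separation

variable {R : LocalSubring F} [IsIntegrallyClosedIn R.toSubring F] {A B : Set (ValuationSubring F)}

lemma not_separated_of_mem {x : F} (hAR : A ⊆ R.dominating) (hBR : B ⊆ R.dominating)
    (hA : R.IsClosedIn A) (hB : R.IsClosedIn B) (hcov : R.dominating ⊆ A ∪ B)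
    (hmax : ∀ R' : LocalSubring F, R ≤ R' → IsIntegrallyClosedIn R'.toSubring F →
      (A ∩ R'.dominating).Nonempty → (B ∩ R'.dominating).Nonempty → R'.toSubring ≤ R.toSubring)
    (hx : x ∉ R.toSubring) (hx' : x⁻¹ ∉ R.toSubring)
    (hxA : ∃ V ∈ A, x ∈ V) (hxB : ∃ V ∈ B, x ∈ V) : False := by
  have hx0 : x ≠ 0 := by rintro rfl; exact hx R.toSubring.zero_mem
  obtain ⟨e, he, heA, heB⟩ := exists_separating hAR hBR hA hB hmax hx
  obtain ⟨e', he', heA', heB'⟩ := exists_separating hAR hBR hA hB hmax hx'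
  have hmem {e : F} {V : ValuationSubring F} (h : e ∈ V.nonunits ∨ 1 - e ∈ V.nonunits) :
      e * (1 - e) ∈ V.nonunits := by
    rcases h with h | h
    · exact V.mul_mem_nonunits h (V.toSubring.sub_mem V.one_mem (V.nonunits_subset h))
    · rw [mul_comm]
      refine V.mul_mem_nonunits h ?_
      simpa using V.toSubring.sub_mem V.one_mem (V.nonunits_subset h)
  obtain ⟨r, hrR, hr⟩ := exists_glue hx0 he he' fun V hV hxV hxV' ↦ by
    rcases hcov hV with h | h
    · have h1 := heA V h hxV
      have h2 := heA' V h hxV'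
      exact ⟨hmem (Or.inl h1), hmem (Or.inl h2), V.nonunits.sub_mem h1 h2⟩
    · have h1 := heB V h hxV
      have h2 := heB' V h hxV'
      refine ⟨hmem (Or.inr h1), hmem (Or.inr h2), ?_⟩
      have : e - e' = (1 - e') - (1 - e) := by ring
      rw [this]
      exact V.nonunits.sub_mem h2 h1
  obtain ⟨V, hV, hxV⟩ := hxA
  obtain ⟨W, hW, hxW⟩ := hxB
  have h1 : r ∈ V.nonunits := by
    have := V.nonunits.sub_mem (heA V hV hxV) (hr V (hAR hV) hxV (hmem (Or.inl (heA V hV hxV))))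
    rwa [sub_sub_cancel] at this
  have h2 : r ∈ W.nonunits := (le_toLocalSubring_iff.1 (hBR hW)).2 ⟨r, hrR⟩
    (mem_maximalIdeal_of_mem_nonunits (hAR hV) h1)
  have h3 := heB W hW hxW
  have h4 := hr W (hBR hW) hxW (hmem (Or.inr h3))
  have : (1 - e) + (e - r) + r = 1 := by ring
  exact W.one_notMem_nonunits (this ▸ W.nonunits.add_mem (W.nonunits.add_mem h3 h4) h2)

lemma not_separated_of_maximal (hAR : A ⊆ R.dominating) (hBR : B ⊆ R.dominating)
    (hA : R.IsClosedIn A) (hB : R.IsClosedIn B) (hcov : R.dominating ⊆ A ∪ B)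
    (hdisj : Disjoint A B) (hAne : A.Nonempty) (hBne : B.Nonempty)
    (hmax : ∀ R' : LocalSubring F, R ≤ R' → IsIntegrallyClosedIn R'.toSubring F →
      (A ∩ R'.dominating).Nonempty → (B ∩ R'.dominating).Nonempty →
      R'.toSubring ≤ R.toSubring) : False := by
  obtain ⟨V₁, h₁⟩ := hAne
  obtain ⟨V₂, h₂⟩ := hBne
  by_cases hR : ∀ x : F, x ∈ R.toSubring ∨ x⁻¹ ∈ R.toSubring
  · let W : ValuationSubring F := ⟨R.toSubring, hR⟩
    have key {V : ValuationSubring F} (hV : V ∈ R.dominating) : V = W :=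
      ValuationSubring.toLocalSubring_injective (W.isMax_toLocalSubring.eq_of_le hV).symm
    exact Set.disjoint_left.1 hdisj h₁ (by rwa [key (hAR h₁), ← key (hBR h₂)])
  push Not at hR
  obtain ⟨x, hx, hx'⟩ := hR
  obtain ⟨V, hV, hxV, hxV'⟩ := exists_mem_dominating_inv_mem hx hx'
  have aux : ((∃ V ∈ A, x ∈ V) ∧ ∃ V ∈ B, x ∈ V) ∨ (∃ V ∈ A, x⁻¹ ∈ V) ∧ ∃ V ∈ B, x⁻¹ ∈ V := by
    rcases hcov hV with h | h
    · exact (V₂.mem_or_inv_mem x).imp (fun h' ↦ ⟨⟨V, h, hxV⟩, V₂, h₂, h'⟩)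
        fun h' ↦ ⟨⟨V, h, hxV'⟩, V₂, h₂, h'⟩
    · exact (V₁.mem_or_inv_mem x).imp (fun h' ↦ ⟨⟨V₁, h₁, h'⟩, V, h, hxV⟩)
        fun h' ↦ ⟨⟨V₁, h₁, h'⟩, V, h, hxV'⟩
  rcases aux with ⟨h, h'⟩ | ⟨h, h'⟩
  · exact not_separated_of_mem hAR hBR hA hB hcov hmax hx hx' h h'
  · exact not_separated_of_mem hAR hBR hA hB hcov hmax hx' (by rwa [inv_inv]) h h'

end Separation

lemma exists_upperBound_of_isChain {c : Set (LocalSubring F)} (hc : IsChain (· ≤ ·) c)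
    (hne : c.Nonempty) (hic : ∀ R ∈ c, IsIntegrallyClosedIn R.toSubring F) :
    ∃ S : LocalSubring F, (∀ R ∈ c, R ≤ S) ∧ IsIntegrallyClosedIn S.toSubring F ∧
      ∀ V : ValuationSubring F, (∀ R ∈ c, V ∈ R.dominating) → V ∈ S.dominating := by
  have : Nonempty c := hne.to_subtype
  have hdir := hc.directed.mono_comp _ LocalSubring.toSubring_mono
  have hmem {a : F} : a ∈ ⨆ i : c, i.1.toSubring ↔ ∃ i : c, a ∈ i.1.toSubring :=
    Subring.mem_iSup_of_directed hdir
  have hle (i : c) : i.1.toSubring ≤ ⨆ i : c, i.1.toSubring :=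
    le_iSup (fun i : c ↦ i.1.toSubring) i
  let S : LocalSubring F := @LocalSubring.mk _ _ (⨆ i : c, i.1.toSubring) ⟨by
    intro ⟨a, ha⟩ ⟨b, hb⟩ e
    obtain ⟨A, haA⟩ := hmem.1 ha
    obtain ⟨B, hbB⟩ := hmem.1 hb
    obtain ⟨C, hCA, hCB⟩ := hdir A B
    refine (C.1.2.2 (a := ⟨a, hCA haA⟩) (b := ⟨b, hCB hbB⟩)
      (Subtype.ext (Subtype.ext_iff.1 e :))).imp ?_ ?_
    · exact fun h ↦ h.map (Subring.inclusion (hle C))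
    · exact fun h ↦ h.map (Subring.inclusion (hle C))⟩
  refine ⟨S, fun A hA ↦ ⟨hle ⟨A, hA⟩, ⟨?_⟩⟩, ?_, fun V hV ↦ ?_⟩
  · rintro ⟨a, haA⟩ h
    obtain ⟨⟨b, hb⟩, e⟩ := isUnit_iff_exists_inv.mp h
    obtain ⟨B, hbB⟩ := hmem.1 hb
    obtain ⟨C, hCA, hCB⟩ := hc.directed ⟨A, hA⟩ B
    apply hCA.2.1
    exact isUnit_iff_exists_inv.mpr ⟨⟨b, hCB.1 hbB⟩, Subtype.ext (Subtype.ext_iff.1 e :)⟩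
  · rw [Subring.isIntegrallyClosedIn_iff]
    rintro y ⟨p, hp, hpy⟩
    classical
    choose f hf using fun i ↦ hmem.1 (p.coeff i).2
    obtain ⟨z, hz⟩ := hdir.finset_le ((Finset.range p.natDegree).image f)
    have := hic z z.2
    refine hle z (Subring.isIntegrallyClosedIn_iff.1 this (isIntegral_of_coeff_mem
      (hp.map (algebraMap _ F)) (fun i hi ↦ ?_) (by rw [← eval₂_eq_eval_map]; exact hpy)))
    rw [hp.natDegree_map] at hi
    rw [coeff_map]
    exact ⟨⟨_, hz _ (Finset.mem_image_of_mem f (Finset.mem_range.2 hi)) (hf i)⟩, rfl⟩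
  · refine le_toLocalSubring_iff.2 ⟨iSup_le fun i ↦ (hV i i.2).1, fun y hy ↦ ?_⟩
    obtain ⟨i, hi⟩ := hmem.1 y.2
    exact (le_toLocalSubring_iff.1 (hV i i.2)).2 ⟨y, hi⟩
      fun hu ↦ hy (hu.map (Subring.inclusion (hle i)))

lemma exists_mem_forall_mem_dominating {R : LocalSubring F} {A : Set (ValuationSubring F)}
    (hA : R.IsClosedIn A) {c : Set (LocalSubring F)} (hc : IsChain (· ≤ ·) c)
    (hne : c.Nonempty) (hR : ∀ z ∈ c, R ≤ z) (h : ∀ z ∈ c, (A ∩ z.dominating).Nonempty) :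
    ∃ V ∈ A, ∀ z ∈ c, V ∈ z.dominating := by
  have : Nonempty c := hne.to_subtype
  obtain ⟨W, hW, hW'⟩ := ValuationSubring.exists_limit (fun z : c ↦ A ∩ z.1.dominating)
    (fun i j ↦ (hc.directed i j).imp fun k hk ↦
      ⟨fun V hV ↦ ⟨hV.1, hk.1.trans hV.2⟩, fun V hV ↦ ⟨hV.1, hk.2.trans hV.2⟩⟩)
    (fun z ↦ h z z.2)
  have hWc (z : LocalSubring F) (hz : z ∈ c) : W ∈ z.dominating := by
    refine le_toLocalSubring_iff.2 ⟨fun y hy ↦ hW' ⟨z, hz⟩ y fun V hV ↦ hV.2.1 hy, fun y hy ↦ ?_⟩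
    rw [ValuationSubring.mem_nonunits_iff_or]
    refine or_iff_not_imp_left.2 fun hy0 hyW ↦ ?_
    obtain ⟨V, hV, hVy⟩ := hW {(y : F)⁻¹} (by simpa using hyW) ⟨z, hz⟩
    have := (le_toLocalSubring_iff.1 hV.2).2 y hy
    rw [ValuationSubring.mem_nonunits_iff_or] at this
    exact this.elim hy0 fun h ↦ h (hVy _ (by simp))
  obtain ⟨z, hz⟩ := hne
  refine ⟨W, hA W ((hR z hz).trans (hWc z hz)) fun s hs ↦ ?_, hWc⟩
  obtain ⟨V, hV, hVs⟩ := hW s hs ⟨z, hz⟩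
  exact ⟨V, hV.1, hVs⟩

/-- The space of valuation rings dominating an integrally closed local ring is preconnected. -/
theorem inter_nonempty_of_isClosedIn {R : LocalSubring F} [IsIntegrallyClosedIn R.toSubring F]
    {A B : Set (ValuationSubring F)} (hAR : A ⊆ R.dominating) (hBR : B ⊆ R.dominating)
    (hA : R.IsClosedIn A) (hB : R.IsClosedIn B) (hcov : R.dominating ⊆ A ∪ B)
    (hAne : A.Nonempty) (hBne : B.Nonempty) : (A ∩ B).Nonempty := by
  by_contra hdisj
  rw [← Set.not_disjoint_iff_nonempty_inter, not_not] at hdisj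
  let Q : Set (LocalSubring F) := {z | R ≤ z ∧ IsIntegrallyClosedIn z.toSubring F ∧
    (A ∩ z.dominating).Nonempty ∧ (B ∩ z.dominating).Nonempty}
  obtain ⟨z, hRz, ⟨-, hz, hzA, hzB⟩, hmax⟩ := zorn_le_nonempty₀ Q (fun c hcQ hc y hy ↦ by
    obtain ⟨S, hS, hSic, hSV⟩ := exists_upperBound_of_isChain hc ⟨y, hy⟩ fun z hz ↦ (hcQ hz).2.1
    obtain ⟨V, hVA, hV⟩ := exists_mem_forall_mem_dominating hA hc ⟨y, hy⟩
      (fun z hz ↦ (hcQ hz).1) fun z hz ↦ (hcQ hz).2.2.1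
    obtain ⟨V', hVB, hV'⟩ := exists_mem_forall_mem_dominating hB hc ⟨y, hy⟩
      (fun z hz ↦ (hcQ hz).1) fun z hz ↦ (hcQ hz).2.2.2
    exact ⟨S, ⟨(hcQ hy).1.trans (hS y hy), hSic, ⟨V, hVA, hSV V hV⟩, V', hVB, hSV V' hV'⟩, hS⟩)
    R ⟨le_rfl, ‹_›, by rwa [Set.inter_eq_left.2 hAR], by rwa [Set.inter_eq_left.2 hBR]⟩
  have hcl {A : Set (ValuationSubring F)} (hA : R.IsClosedIn A) :
      z.IsClosedIn (A ∩ z.dominating) := fun W hW hs ↦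
    ⟨hA W (hRz.trans hW) fun s hs' ↦ (hs s hs').imp fun V hV ↦ ⟨hV.1.1, hV.2⟩, hW⟩
  refine not_separated_of_maximal (R := z) Set.inter_subset_right Set.inter_subset_right (hcl hA)
    (hcl hB) (fun V hV ↦ (hcov (hRz.trans hV)).imp (fun h ↦ ⟨h, hV⟩) fun h ↦ ⟨h, hV⟩)
    (hdisj.mono Set.inter_subset_left Set.inter_subset_left) hzA hzB fun R' hR' hic h1 h2 ↦
    (hmax ⟨hRz.trans hR', hic, h1.mono ?_, h2.mono ?_⟩ hR').1
  · exact Set.inter_subset_inter_left _ Set.inter_subset_left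
  · exact Set.inter_subset_inter_left _ Set.inter_subset_left

end LocalSubring

namespace IsValSubring

/-- A valuation ring of `F` as a term of `ValuationSubring F`. -/
def toValuationSubring {V : Subring F} (hV : IsValSubring V) : ValuationSubring F where
  __ := V
  mem_or_inv_mem' x := by
    by_cases hx : x = 0
    · exact Or.inl (hx ▸ V.zero_mem)
    · exact hV x hx

end IsValSubring

lemma ValuationSubring.isValSubring (V : ValuationSubring F) : IsValSubring V.toSubring :=
  fun x _ ↦ V.mem_or_inv_mem x

lemma memMaxIdeal_toSubring_iff (V : ValuationSubring F) (x : F) :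
    MemMaxIdeal V.toSubring x ↔ x ∈ V.nonunits := by
  constructor
  · rintro ⟨h, hu⟩
    exact V.coe_mem_nonunits_iff.2 (show (⟨x, h⟩ : V) ∈ maximalIdeal V from hu)
  · intro h
    refine ⟨V.nonunits_subset h, ?_⟩
    exact (V.coe_mem_nonunits_iff (a := ⟨x, V.nonunits_subset h⟩)).1 h

lemma dominates_toSubring_iff {R : LocalSubring F} {V : ValuationSubring F} :
    Dominates V.toSubring R.toSubring ↔ V ∈ R.dominating := by
  refine Iff.trans ?_ LocalSubring.le_toLocalSubring_iff.symm
  refine and_congr_right fun hle ↦ ?_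
  simp only [memMaxIdeal_toSubring_iff]
  constructor
  · exact fun h y hy ↦ (h y y.2).1 ⟨y.2, hy⟩
  · refine fun h x hx ↦ ⟨fun ⟨hx, hx'⟩ ↦ h ⟨x, hx⟩ hx', fun hxV ↦ ⟨hx, ?_⟩⟩
    exact LocalSubring.mem_maximalIdeal_of_mem_nonunits (y := ⟨x, hx⟩)
      (LocalSubring.le_toLocalSubring_iff.2 ⟨hle, h⟩) hxV

lemma Dominates.trans {R S T : Subring F} (h : Dominates R S) (h' : Dominates S T) :
    Dominates R T :=
  ⟨h'.1.trans h.1, fun x hx ↦ (h'.2 x hx).trans (h.2 x (h'.1 hx))⟩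

lemma IntegrallyClosedIn.isIntegrallyClosedIn {R : Subring F} (h : IntegrallyClosedIn R) :
    IsIntegrallyClosedIn R F := by
  rw [Subring.isIntegrallyClosedIn_iff]
  rintro x ⟨p, hp, hpx⟩
  refine h x ⟨p.map (algebraMap R F), hp.map _, fun i ↦ ?_, by rwa [← eval₂_eq_eval_map]⟩
  rw [coeff_map]
  exact (p.coeff i).2

lemma isOpen_setOf_mem (X : Set (Subring F)) (y : F) :
    @IsOpen _ (zariskiTop X) {V : X | y ∈ (V : Subring F)} :=
  .basic _ ⟨{y}, by simp⟩

lemma exists_finset_of_isOpen {X : Set (Subring F)} {U : Set X} (hU : @IsOpen _ (zariskiTop X) U)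
    {V : X} (hV : V ∈ U) : ∃ s : Finset F, (∀ y ∈ s, y ∈ (V : Subring F)) ∧
      ∀ W : X, (∀ y ∈ s, y ∈ (W : Subring F)) → W ∈ U := by
  classical
  induction hU with
  | basic U hU =>
    obtain ⟨s, rfl⟩ := hU
    exact ⟨s, hV, fun W hW ↦ hW⟩
  | univ => exact ⟨∅, by simp, fun _ _ ↦ trivial⟩
  | inter U U' _ _ ih ih' =>
    obtain ⟨s, hs, h⟩ := ih hV.1
    obtain ⟨s', hs', h'⟩ := ih' hV.2
    refine ⟨s ∪ s', fun y hy ↦ (Finset.mem_union.1 hy).elim (hs y) (hs' y), fun W hW ↦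
      ⟨h W fun y hy ↦ hW y (Finset.mem_union_left _ hy),
        h' W fun y hy ↦ hW y (Finset.mem_union_right _ hy)⟩⟩
  | sUnion S _ ih =>
    obtain ⟨U, hU, hVU⟩ := hV
    obtain ⟨s, hs, h⟩ := ih U hU hVU
    exact ⟨s, hs, fun W hW ↦ ⟨U, hU, h W hW⟩⟩

lemma exists_inv_mem_of_not_dominates {D : Subring F} {R : LocalSubring F} {V : ValuationSubring F}
    (hra : ResiduallyAlgebraic D R.toSubring) (hV : D ≤ V.toSubring) (h : V ∉ R.dominating) :
    ∃ y ≠ 0, MemMaxIdeal R.toSubring y ∧ y⁻¹ ∈ V := by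
  by_cases hle : R.toSubring ≤ V.toSubring
  · by_contra! hcon
    refine h (LocalSubring.le_toLocalSubring_iff.2 ⟨hle, fun y hy ↦ ?_⟩)
    rw [ValuationSubring.mem_nonunits_iff_or]
    exact or_iff_not_imp_left.2 fun hy0 ↦ hcon y hy0 ⟨y.2, hy⟩
  · obtain ⟨x, hxR, hxV⟩ := SetLike.not_le_iff_exists.1 hle
    obtain ⟨p, hp, hpD, hpx⟩ := hra x hxR
    have key : p.eval x ∉ V := by
      intro hmem
      refine hxV ?_
      suffices IsIntegral V x by
        obtain ⟨z, hz⟩ := IsIntegrallyClosed.isIntegral_iff.1 this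
        rw [← hz]
        exact z.2
      let q : V[X] := toSubring p V.toSubring fun a ha ↦ by
        obtain ⟨i, -, rfl⟩ := mem_coeffs_iff.1 ha
        exact hV (hpD i)
      have hq : q.map (algebraMap V F) = p := map_toSubring ..
      have hq' : q.Monic := (monic_toSubring ..).2 hp
      refine IsIntegral.of_aeval_monic (p := q) hq' (fun hdeg ↦ ?_) ?_
      · obtain ⟨h1, h1'⟩ := hpx
        have hp1 : p = 1 := by rw [← hq, hq'.natDegree_eq_zero.1 hdeg, Polynomial.map_one]
        subst hp1
        exact h1' (by simp only [eval_one]; exact isUnit_one)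
      · rw [aeval_def, eval₂_eq_eval_map, hq]
        exact isIntegral_algebraMap (x := (⟨p.eval x, hmem⟩ : V))
    refine ⟨p.eval x, fun h0 ↦ key (h0 ▸ V.zero_mem), hpx, (V.mem_or_inv_mem _).resolve_left key⟩

end

/-- If `D ⊆ R` are local subrings of `F` such that `R` dominates `D`, `R` is
integrally closed in `F` and `R` is residually algebraic over `D`, then `Dom_F(R)`
is a closed and connected subset of `Dom_F(D)`. -/
theorem statement14 (D R : Subring F) (hD : IsLocalRing D) (hR : IsLocalRing R)
    (hDR : D ≤ R) (hdom : Dominates R D) (hic : IntegrallyClosedIn R)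
    (hra : ResiduallyAlgebraic D R) :
    @IsClosed _ (zariskiTop (domSet D)) {V : ↥(domSet D) | Dominates V.1 R} ∧
    @IsConnected _ (zariskiTop (domSet D)) {V : ↥(domSet D) | Dominates V.1 R} := by
  let := zariskiTop (domSet D)
  let R' : LocalSubring F := ⟨R⟩
  have hic' : IsIntegrallyClosedIn R'.toSubring F := hic.isIntegrallyClosedIn
  have hdomD {V : ValuationSubring F} (hV : V ∈ R'.dominating) : V.toSubring ∈ domSet D :=
    ⟨V.isValSubring, (dominates_toSubring_iff.2 hV).trans hdom⟩
  refine ⟨?_, ?_, ?_⟩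
  · rw [← isOpen_compl_iff, isOpen_iff_forall_mem_open]
    intro V hV
    obtain ⟨y, hy0, hyR, hyV⟩ := exists_inv_mem_of_not_dominates (R := R')
      (V := V.2.1.toValuationSubring) hra V.2.2.1 (mt dominates_toSubring_iff.2 hV)
    refine ⟨_, fun W hW hWR ↦ ?_, isOpen_setOf_mem _ y⁻¹, hyV⟩
    have := (memMaxIdeal_toSubring_iff W.2.1.toValuationSubring y).1 ((hWR.2 y hyR.1).1 hyR)
    rw [ValuationSubring.mem_nonunits_iff_or] at this
    exact this.elim hy0 fun h ↦ h hW
  · obtain ⟨V, hV⟩ := R'.exists_le_valuationSubring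
    exact ⟨⟨V.toSubring, hdomD hV⟩, dominates_toSubring_iff.2 hV⟩
  · rw [isPreconnected_closed_iff]
    rintro t t' ht ht' hcov ⟨V₁, h₁, h₁'⟩ ⟨V₂, h₂, h₂'⟩
    let A (t : Set (domSet D)) : Set (ValuationSubring F) :=
      {V | ∃ h : V ∈ R'.dominating, (⟨V.toSubring, hdomD h⟩ : domSet D) ∈ t}
    have hA {t : Set (domSet D)} (ht : IsClosed t) : R'.IsClosedIn (A t) := by
      intro W hW hs
      refine ⟨hW, ?_⟩
      by_contra hWt
      obtain ⟨s, hs', h⟩ := exists_finset_of_isOpen ht.isOpen_compl hWt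
      obtain ⟨V, ⟨hV, hVt⟩, hVs⟩ := hs s hs'
      exact h ⟨V.toSubring, hdomD hV⟩ hVs hVt
    have hmem {V : domSet D} {t : Set (domSet D)} (hV : Dominates V.1 R) (hVt : V ∈ t) :
        V.2.1.toValuationSubring ∈ A t := ⟨dominates_toSubring_iff.1 hV, hVt⟩
    obtain ⟨V, ⟨hV, hVt⟩, ⟨_, hVt'⟩⟩ := LocalSubring.inter_nonempty_of_isClosedIn (R := R')
      (fun V hV ↦ hV.1) (fun V hV ↦ hV.1) (hA ht) (hA ht')
      (fun V hV ↦ (hcov (a := ⟨V.toSubring, hdomD hV⟩) (dominates_toSubring_iff.2 hV)).imp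
        (fun h ↦ ⟨hV, h⟩) fun h ↦ ⟨hV, h⟩) ⟨_, hmem h₁ h₁'⟩ ⟨_, hmem h₂ h₂'⟩
    exact ⟨_, dominates_toSubring_iff.2 hV, hVt, hVt'⟩
end
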